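/- arXiv:2508.05392 — 2 statements merged into one kernel-verified Lean document; each statement's English description precedes it below -/
import Mathlib

section
/- Let c₁, c₂ > 0 and set 𝔻_{c₁,c₂} = {N ∈ 𝔻 : c₁ d^{1/2} ≤ N ≤ c₂ d}. There exists a constant C > 0 depending only on c₁ and c₂ (independent of the dimension d) such that for every d ≥ 1 and every f ∈ ℓ₂(ℤ^d; ℂ), ‖ sup_{N ∈ 𝔻_{c₁,c₂}} |M_N^B f| ‖_{ℓ₂(ℤ^d)} ≤ C ‖f‖_{ℓ₂(ℤ^d)}. (Scalar-valued case of Lemma 3.8, the intermediate-scale estimate.) -/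
open MeasureTheory ENNReal

/-- The set of lattice points in the closed Euclidean ball of radius `N`
centered at the origin of `ℝ^d`. -/
def latticeBallSet (d : ℕ) (N : ℝ) : Set (Fin d → ℤ) :=
  {y | ∑ j, ((y j : ℝ)) ^ 2 ≤ N ^ 2}

/-- The discrete Hardy–Littlewood averaging operator over the Euclidean ball
of radius `N`: `M_N^B f (x) = (1/#(B_N ∩ ℤ^d)) ∑_{y ∈ B_N ∩ ℤ^d} f (x - y)`. -/
noncomputable def ballAvg (d : ℕ) (N : ℝ) (f : (Fin d → ℤ) → ℂ) (x : Fin d → ℤ) : ℂ :=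
  (∑ᶠ y ∈ latticeBallSet d N, f (x - y)) / ((latticeBallSet d N).ncard : ℂ)

/-- The `ℓ_p` norm on `ℤ^d` of an `ℝ≥0∞`-valued function. -/
noncomputable def lpNorm (d : ℕ) (p : ℝ) (g : (Fin d → ℤ) → ℝ≥0∞) : ℝ≥0∞ :=
  (∑' x : Fin d → ℤ, (g x) ^ p) ^ (1 / p)

/-- The squared Euclidean norm of a lattice point. -/
def latticeNormSq {d : ℕ} (x : Fin d → ℤ) : ℕ := ∑ j, (x j).natAbs ^ 2

/-- The lattice points of squared norm at most `n`. -/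
noncomputable def latticeBall (d n : ℕ) : Finset (Fin d → ℤ) :=
  (Fintype.piFinset fun _ => Finset.Icc (-(n : ℤ)) n).filter fun x => latticeNormSq x ≤ n

/-- The integers of absolute value at most `L`. -/
noncomputable def symmIcc (L : ℕ) : Finset ℤ := Finset.Icc (-(L : ℤ)) L

lemma mem_symmIcc {L : ℕ} {k : ℤ} : k ∈ symmIcc L ↔ k.natAbs ≤ L := by
  simp only [symmIcc, Finset.mem_Icc]; omega

lemma card_symmIcc (L : ℕ) : (symmIcc L).card = 2 * L + 1 := by
  simp only [symmIcc, Int.card_Icc]; omega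

lemma natAbs_sq_le_latticeNormSq {d : ℕ} (x : Fin d → ℤ) (j : Fin d) :
    (x j).natAbs ^ 2 ≤ latticeNormSq x :=
  Finset.single_le_sum (f := fun i => (x i).natAbs ^ 2) (fun _ _ => Nat.zero_le _)
    (Finset.mem_univ j)

lemma mem_latticeBall {d n : ℕ} {x : Fin d → ℤ} :
    x ∈ latticeBall d n ↔ latticeNormSq x ≤ n := by
  simp only [latticeBall, Finset.mem_filter, Fintype.mem_piFinset, Finset.mem_Icc,
    and_iff_right_iff_imp]
  intro h j
  have h1 := (natAbs_sq_le_latticeNormSq x j).trans h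
  have h2 : (x j).natAbs ≤ (x j).natAbs ^ 2 := Nat.le_self_pow two_ne_zero _
  omega

lemma latticeNormSq_cons {d : ℕ} (k : ℤ) (y : Fin d → ℤ) :
    latticeNormSq (Fin.cons k y : Fin (d + 1) → ℤ) = k.natAbs ^ 2 + latticeNormSq y := by
  simp [latticeNormSq, Fin.sum_univ_succ]

lemma zero_mem_latticeBall (d n : ℕ) : (0 : Fin d → ℤ) ∈ latticeBall d n := by
  simp [mem_latticeBall, latticeNormSq]

lemma card_latticeBall_pos (d n : ℕ) : 0 < (latticeBall d n).card :=
  Finset.card_pos.2 ⟨0, zero_mem_latticeBall d n⟩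

lemma latticeBall_mono (d : ℕ) {m n : ℕ} (h : m ≤ n) : latticeBall d m ⊆ latticeBall d n :=
  fun _ hx => mem_latticeBall.2 ((mem_latticeBall.1 hx).trans h)

/-- Slicing the ball by its first coordinate. -/
lemma sum_latticeBall_succ {M : Type*} [AddCommMonoid M] (d n : ℕ) (F : (Fin (d + 1) → ℤ) → M) :
    ∑ x ∈ latticeBall (d + 1) n, F x =
      ∑ k ∈ symmIcc n.sqrt, ∑ y ∈ latticeBall d (n - k.natAbs ^ 2), F (Fin.cons k y) := by
  rw [Finset.sum_sigma']
  refine Finset.sum_bij' (fun x _ => (⟨x 0, Fin.tail x⟩ : Σ _ : ℤ, (Fin d → ℤ)))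
    (fun p _ => Fin.cons p.1 p.2) ?_ ?_ ?_ ?_ ?_
  · intro x hx
    rw [mem_latticeBall, ← Fin.cons_self_tail x, latticeNormSq_cons] at hx
    simp only [Finset.mem_sigma, mem_symmIcc, mem_latticeBall, Nat.le_sqrt']
    omega
  · rintro ⟨k, y⟩ h
    simp only [Finset.mem_sigma, mem_symmIcc, mem_latticeBall, Nat.le_sqrt'] at h
    rw [mem_latticeBall, latticeNormSq_cons]
    simp at h ⊢; omega
  · intro x _; simp
  · rintro ⟨k, y⟩ _; simp
  · intro x _; simp

/-- Slicing the ball into the fibers of the projection that forgets the first coordinate. -/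
lemma sum_latticeBall_succ' {M : Type*} [AddCommMonoid M] (d n : ℕ)
    (F : (Fin (d + 1) → ℤ) → M) :
    ∑ x ∈ latticeBall (d + 1) n, F x =
      ∑ y ∈ latticeBall d n, ∑ k ∈ symmIcc (n - latticeNormSq y).sqrt, F (Fin.cons k y) := by
  rw [sum_latticeBall_succ]
  refine Finset.sum_comm' fun k y => ?_
  simp only [mem_symmIcc, mem_latticeBall, Nat.le_sqrt']
  omega

/-- The number of lattice points of squared norm at most `n`, as a real number. -/
noncomputable def ballCount (d n : ℕ) : ℝ := (latticeBall d n).card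

lemma ballCount_pos (d n : ℕ) : 0 < ballCount d n := by
  rw [ballCount]
  exact_mod_cast card_latticeBall_pos d n

lemma ballCount_mono (d : ℕ) {m n : ℕ} (h : m ≤ n) : ballCount d m ≤ ballCount d n := by
  rw [ballCount, ballCount]
  exact_mod_cast Finset.card_le_card (latticeBall_mono d h)

lemma ballCount_zero (n : ℕ) : ballCount 0 n = 1 := by
  have : latticeBall 0 n = {0} := by
    ext x
    simp [mem_latticeBall, latticeNormSq, Subsingleton.elim x 0]
  simp [ballCount, this]

lemma ballCount_eq_sum (d n : ℕ) : ballCount d n = ∑ _x ∈ latticeBall d n, (1 : ℝ) := by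
  simp [ballCount]

lemma ballCount_succ (d n : ℕ) :
    ballCount (d + 1) n = ∑ k ∈ symmIcc n.sqrt, ballCount d (n - k.natAbs ^ 2) := by
  rw [ballCount_eq_sum, sum_latticeBall_succ]
  simp [ballCount]

lemma ballCount_le_succ (d n : ℕ) : ballCount d n ≤ ballCount (d + 1) n := by
  rw [ballCount_succ]
  have h := Finset.single_le_sum (f := fun k : ℤ => ballCount d (n - k.natAbs ^ 2))
    (fun k _ => (ballCount_pos _ _).le) (mem_symmIcc.2 (Nat.zero_le _) : (0 : ℤ) ∈ symmIcc n.sqrt)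
  simpa using h

/-- The ball is invariant under permutations of the coordinates. -/
lemma sum_latticeBall_perm {M : Type*} [AddCommMonoid M] {d : ℕ} (n : ℕ)
    (σ : Equiv.Perm (Fin d)) (F : (Fin d → ℤ) → M) :
    ∑ x ∈ latticeBall d n, F (x ∘ σ) = ∑ x ∈ latticeBall d n, F x := by
  have key : ∀ (τ : Equiv.Perm (Fin d)) (x : Fin d → ℤ),
      latticeNormSq (x ∘ τ) = latticeNormSq x := fun τ x =>
    Equiv.sum_comp τ fun j => (x j).natAbs ^ 2
  refine Finset.sum_bij' (fun x _ => x ∘ σ) (fun x _ => x ∘ σ.symm) ?_ ?_ ?_ ?_ ?_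
  · intro x hx; rw [mem_latticeBall, key]; exact mem_latticeBall.1 hx
  · intro x hx; rw [mem_latticeBall, key]; exact mem_latticeBall.1 hx
  · intro x _; ext; simp
  · intro x _; ext; simp
  · intro x _; rfl

/-- Any function of one coordinate has the same sum over the ball as for the first coordinate. -/
lemma sum_latticeBall_coord {M : Type*} [AddCommMonoid M] {d : ℕ} (n : ℕ) (j : Fin (d + 1))
    (g : ℤ → M) : ∑ x ∈ latticeBall (d + 1) n, g (x j) = ∑ x ∈ latticeBall (d + 1) n, g (x 0) := by
  rw [← sum_latticeBall_perm n (Equiv.swap 0 j) fun x => g (x 0)]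
  simp

/-- The cumulative count `∑_{m < n} #B_m`. -/
noncomputable def cumCount (d n : ℕ) : ℝ := ∑ m ∈ Finset.range n, ballCount d m

lemma cumCount_succ (d n : ℕ) : cumCount d (n + 1) = cumCount d n + ballCount d n :=
  Finset.sum_range_succ _ _

lemma cumCount_eq_sum (d n : ℕ) :
    cumCount d n = ∑ x ∈ latticeBall d n, ((n : ℝ) - latticeNormSq x) := by
  have h1 : ∀ m ∈ Finset.range n, ballCount d m =
      ∑ x ∈ latticeBall d n, if latticeNormSq x ≤ m then (1 : ℝ) else 0 := by
    intro m hm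
    have hm := Finset.mem_range.1 hm
    rw [← Finset.sum_filter, ballCount_eq_sum]
    refine Finset.sum_congr ?_ fun _ _ => rfl
    ext x
    simp only [Finset.mem_filter, mem_latticeBall]
    omega
  rw [cumCount, Finset.sum_congr rfl h1, Finset.sum_comm]
  refine Finset.sum_congr rfl fun x hx => ?_
  have hx := mem_latticeBall.1 hx
  rw [← Finset.sum_filter, Finset.sum_const, nsmul_eq_mul, mul_one, ← Nat.cast_sub hx]
  congr 1
  have : (Finset.range n).filter (fun m => latticeNormSq x ≤ m) =
      Finset.Ico (latticeNormSq x) n := by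
    ext; simp; omega
  rw [this, Nat.card_Ico]

/-- The sum of the squares of the first coordinates over the ball. -/
noncomputable def coordSqSum (d n : ℕ) : ℝ :=
  ∑ x ∈ latticeBall (d + 1) n, ((x 0 : ℤ) : ℝ) ^ 2

lemma sum_coord_sq (d n : ℕ) (j : Fin (d + 1)) :
    ∑ x ∈ latticeBall (d + 1) n, ((x j : ℤ) : ℝ) ^ 2 = coordSqSum d n :=
  sum_latticeBall_coord n j fun k : ℤ => (k : ℝ) ^ 2

lemma cast_latticeNormSq {d : ℕ} (x : Fin d → ℤ) :
    (latticeNormSq x : ℝ) = ∑ j, (x j : ℝ) ^ 2 := by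
  simp [latticeNormSq, Nat.cast_natAbs]

lemma succ_mul_coordSqSum (d n : ℕ) :
    ((d : ℝ) + 1) * coordSqSum d n =
      ∑ x ∈ latticeBall (d + 1) n, (latticeNormSq x : ℝ) := by
  simp_rw [cast_latticeNormSq]
  rw [Finset.sum_comm]
  simp_rw [sum_coord_sq]
  simp

lemma succ_mul_coordSqSum_eq (d n : ℕ) :
    ((d : ℝ) + 1) * coordSqSum d n = n * ballCount (d + 1) n - cumCount (d + 1) n := by
  rw [succ_mul_coordSqSum, cumCount_eq_sum, Finset.sum_sub_distrib, ballCount]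
  simp
  ring

lemma three_mul_sum_sq_symmIcc (L : ℕ) :
    3 * ∑ k ∈ symmIcc L, (k : ℝ) ^ 2 = (2 * L + 1) * (L * (L + 1)) := by
  induction L with
  | zero => simp [symmIcc]
  | succ L ih =>
    have : symmIcc (L + 1) = insert (-(L + 1 : ℤ)) (insert (L + 1 : ℤ) (symmIcc L)) := by
      ext k; simp only [Finset.mem_insert, mem_symmIcc]; omega
    rw [this, Finset.sum_insert, Finset.sum_insert, mul_add, mul_add, ih]
    · push_cast; ring
    · simp only [mem_symmIcc]; omega
    · simp only [Finset.mem_insert, mem_symmIcc]; omega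

/-- The second moment of a coordinate, computed on the fibers of the projection. -/
lemma three_mul_coordSqSum (d n : ℕ) :
    3 * coordSqSum d n = ∑ y ∈ latticeBall d n,
      (2 * ((n - latticeNormSq y).sqrt : ℝ) + 1) *
        ((n - latticeNormSq y).sqrt * ((n - latticeNormSq y).sqrt + 1)) := by
  rw [coordSqSum, sum_latticeBall_succ', Finset.mul_sum]
  refine Finset.sum_congr rfl fun y _ => ?_
  rw [← three_mul_sum_sq_symmIcc]
  simp

lemma cumCount_add_coordSqSum (d n : ℕ) :
    cumCount (d + 1) n + coordSqSum d n = ∑ y ∈ latticeBall d n,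
      (2 * ((n - latticeNormSq y).sqrt : ℝ) + 1) * ((n - latticeNormSq y : ℕ) : ℝ) := by
  rw [cumCount_eq_sum, coordSqSum, ← Finset.sum_add_distrib, sum_latticeBall_succ']
  refine Finset.sum_congr rfl fun y hy => ?_
  have hy := mem_latticeBall.1 hy
  rw [Nat.cast_sub hy]
  have : ∀ k ∈ symmIcc (n - latticeNormSq y).sqrt,
      ((n : ℝ) - latticeNormSq (Fin.cons k y : Fin (d + 1) → ℤ) +
        (((Fin.cons k y : Fin (d + 1) → ℤ) 0 : ℤ) : ℝ) ^ 2) = n - latticeNormSq y := by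
    intro k _
    rw [latticeNormSq_cons]
    push_cast
    simp only [Fin.cons_zero, Nat.cast_natAbs, Int.cast_abs, sq_abs]
    ring
  rw [Finset.sum_congr rfl this, Finset.sum_const, card_symmIcc, nsmul_eq_mul]
  push_cast
  ring

lemma ballCount_succ_eq_sum (d n : ℕ) :
    ballCount (d + 1) n =
      ∑ y ∈ latticeBall d n, (2 * ((n - latticeNormSq y).sqrt : ℝ) + 1) := by
  rw [ballCount_eq_sum, sum_latticeBall_succ']
  simp [card_symmIcc]

lemma coordSqSum_upper (d n : ℕ) :
    6 * coordSqSum d n ≤ 3 * (cumCount (d + 1) n + coordSqSum d n) + ballCount (d + 1) n := by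
  have h : 6 * coordSqSum d n = 2 * (3 * coordSqSum d n) := by ring
  rw [h, three_mul_coordSqSum, cumCount_add_coordSqSum, ballCount_succ_eq_sum, Finset.mul_sum,
    Finset.mul_sum, ← Finset.sum_add_distrib]
  refine Finset.sum_le_sum fun y _ => ?_
  set R := n - latticeNormSq y
  have h1 : ((R.sqrt : ℝ)) ^ 2 ≤ R := by exact_mod_cast Nat.sqrt_le' R
  have h2 : (0 : ℝ) ≤ R.sqrt := Nat.cast_nonneg _
  nlinarith [sq_nonneg ((R.sqrt : ℝ) - 1), mul_nonneg h2 (sub_nonneg.2 h1),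
    mul_nonneg h2 (sq_nonneg ((R.sqrt : ℝ) - 1))]

lemma coordSqSum_lower (d n : ℕ) :
    3 * (cumCount (d + 1) n + coordSqSum d n) ≤
      12 * coordSqSum d n + 4 * ballCount (d + 1) n := by
  have h : 12 * coordSqSum d n = 4 * (3 * coordSqSum d n) := by ring
  rw [h, three_mul_coordSqSum, cumCount_add_coordSqSum, ballCount_succ_eq_sum, Finset.mul_sum,
    Finset.mul_sum, Finset.mul_sum, ← Finset.sum_add_distrib]
  refine Finset.sum_le_sum fun y _ => ?_
  set R := n - latticeNormSq y
  have h1 : (R : ℝ) ≤ (R.sqrt : ℝ) ^ 2 + 2 * R.sqrt := by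
    have := Nat.sqrt_le_add R
    have h' : R ≤ R.sqrt ^ 2 + 2 * R.sqrt := by rw [pow_two]; omega
    exact_mod_cast h'
  have h2 : (0 : ℝ) ≤ R.sqrt := Nat.cast_nonneg _
  have h3 : 0 ≤ 4 * ((R.sqrt : ℝ) * (R.sqrt + 1)) + 4 - 3 * R := by
    nlinarith [sq_nonneg ((R.sqrt : ℝ) - 1)]
  nlinarith [mul_nonneg (by linarith : (0 : ℝ) ≤ 2 * R.sqrt + 1) h3]

lemma cumCount_nonneg (d n : ℕ) : 0 ≤ cumCount d n :=
  Finset.sum_nonneg fun _ _ => (ballCount_pos _ _).le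

lemma mul_ballCount_le_cumCount {D n : ℕ} (hD : 1 ≤ D) (h : D ≤ n) :
    (n : ℝ) * ballCount D n ≤ 3 * D * cumCount D n := by
  obtain ⟨d, rfl⟩ : ∃ d, D = d + 1 := ⟨D - 1, by omega⟩
  have h1 := coordSqSum_upper d n
  have h2 := succ_mul_coordSqSum_eq d n
  have h3 : ((d : ℝ) + 1) ≤ n := by exact_mod_cast h
  have h4 := cumCount_nonneg (d + 1) n
  have h5 := ballCount_pos (d + 1) n
  have hd : (0 : ℝ) ≤ d := Nat.cast_nonneg d
  push_cast
  have h6 := mul_le_mul_of_nonneg_left h1 (by linarith : (0 : ℝ) ≤ (d : ℝ) + 1)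
  have h7 := mul_le_mul_of_nonneg_right h3 h5.le
  nlinarith [mul_nonneg hd h4]

lemma mul_cumCount_le_ballCount {D n : ℕ} (hD : 1 ≤ D) (h : D ≤ n) :
    (D : ℝ) * cumCount D n ≤ 5 * n * ballCount D n := by
  obtain ⟨d, rfl⟩ : ∃ d, D = d + 1 := ⟨D - 1, by omega⟩
  have h1 := coordSqSum_lower d n
  have h2 := succ_mul_coordSqSum_eq d n
  have h3 : ((d : ℝ) + 1) ≤ n := by exact_mod_cast h
  have h4 := cumCount_nonneg (d + 1) n
  have h5 := ballCount_pos (d + 1) n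
  have hd : (0 : ℝ) ≤ d := Nat.cast_nonneg d
  push_cast
  have h6 := mul_le_mul_of_nonneg_left h1 (by linarith : (0 : ℝ) ≤ (d : ℝ) + 1)
  have h7 := mul_le_mul_of_nonneg_right h3 h5.le
  nlinarith [mul_nonneg hd h4]

/-- A discrete Grönwall estimate for the cumulative count. -/
lemma cumCount_growth {D n m : ℕ} (hD : 1 ≤ D) (hn : 2 * D ≤ n) (hm : n ≤ 2 * m) (k : ℕ) :
    cumCount D (m + k) ≤ cumCount D m * Real.exp (6 * D / n * k) := by
  have hn0 : (0 : ℝ) < n := by exact_mod_cast (by omega : 0 < n)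
  induction k with
  | zero => simp
  | succ k ih =>
    rw [← add_assoc, cumCount_succ]
    have hmk : (n : ℝ) ≤ 2 * ((m + k : ℕ) : ℝ) := by exact_mod_cast (by omega : n ≤ 2 * (m + k))
    have h1 := mul_ballCount_le_cumCount hD (by omega : D ≤ m + k)
    have h0 := cumCount_nonneg D (m + k)
    have h2 : ballCount D (m + k) ≤ 6 * D / n * cumCount D (m + k) := by
      rw [div_mul_eq_mul_div, le_div_iff₀ hn0]
      nlinarith [ballCount_pos D (m + k)]
    calc cumCount D (m + k) + ballCount D (m + k)
        ≤ cumCount D (m + k) * (6 * D / n + 1) := by linarith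
      _ ≤ cumCount D (m + k) * Real.exp (6 * D / n) :=
          mul_le_mul_of_nonneg_left (Real.add_one_le_exp _) h0
      _ ≤ cumCount D m * Real.exp (6 * D / n * k) * Real.exp (6 * D / n) :=
          mul_le_mul_of_nonneg_right ih (Real.exp_pos _).le
      _ = _ := by
          rw [mul_assoc, ← Real.exp_add]; push_cast; ring_nf

/-- Shrinking the squared radius by a factor `1 - 1/(2 * D)` costs only a constant factor. -/
lemma ballCount_le_shrink {D n k : ℕ} (hD : 1 ≤ D) (hn : 2 * D ≤ n) (hk : k * (2 * D) ≤ n) :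
    ballCount D n ≤ 15 * Real.exp 3 * ballCount D (n - k) := by
  have hk2 : 2 * k ≤ n := by nlinarith
  obtain ⟨m, rfl⟩ : ∃ m, n = m + k := ⟨n - k, by omega⟩
  rw [Nat.add_sub_cancel]
  have hn0 : (0 : ℝ) < (m + k : ℕ) := by exact_mod_cast (by omega : 0 < m + k)
  have hD0 : (0 : ℝ) < D := by exact_mod_cast hD
  have h1 := mul_ballCount_le_cumCount hD (by omega : D ≤ m + k)
  have h2 := mul_cumCount_le_ballCount hD (by omega : D ≤ m)
  have h3 := cumCount_growth hD hn (by omega : m + k ≤ 2 * m) k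
  have h4 : 6 * (D : ℝ) / (m + k : ℕ) * k ≤ 3 := by
    rw [div_mul_eq_mul_div, div_le_iff₀ hn0]
    have : ((k * (2 * D) : ℕ) : ℝ) ≤ (m + k : ℕ) := by exact_mod_cast hk
    push_cast at this ⊢
    nlinarith
  have h5 := Real.exp_le_exp.2 h4
  have hm : (m : ℝ) ≤ (m + k : ℕ) := by exact_mod_cast (by omega : m ≤ m + k)
  have e := Real.exp_pos 3
  have hG := ballCount_pos D m
  have h6 : ((m + k : ℕ) : ℝ) * ballCount D (m + k) ≤
      (m + k : ℕ) * (15 * Real.exp 3 * ballCount D m) := by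
    calc ((m + k : ℕ) : ℝ) * ballCount D (m + k) ≤ 3 * D * cumCount D (m + k) := h1
      _ ≤ 3 * D * (cumCount D m * Real.exp 3) := by
          gcongr
          exact h3.trans (mul_le_mul_of_nonneg_left h5 (cumCount_nonneg _ _))
      _ = 3 * Real.exp 3 * (D * cumCount D m) := by ring
      _ ≤ 3 * Real.exp 3 * (5 * m * ballCount D m) := by gcongr
      _ = m * (15 * Real.exp 3 * ballCount D m) := by ring
      _ ≤ _ := by gcongr
  exact le_of_mul_le_mul_left h6 hn0

/-- A coordinate hyperplane carries at most a proportion `O(√(d/n))` of the ball. -/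
lemma exists_ballCount_slice_le : ∃ C : ℝ, 1 ≤ C ∧ ∀ d n : ℕ,
    ballCount d n * √n ≤ C * √(d + 1) * ballCount (d + 1) n := by
  have he : (1 : ℝ) ≤ Real.exp 3 := Real.one_le_exp (by norm_num)
  refine ⟨30 * Real.exp 3, by linarith, fun d n => ?_⟩
  have hG := ballCount_pos d n
  have hG' := ballCount_pos (d + 1) n
  have hle := ballCount_le_succ d n
  have hs1 : (1 : ℝ) ≤ √((d : ℝ) + 1) :=
    Real.one_le_sqrt.2 (by linarith [Nat.cast_nonneg (α := ℝ) d])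
  rcases Nat.lt_or_ge n (2 * (d + 1)) with hn | hn
  · have h1 : √(n : ℝ) ≤ 2 * √((d : ℝ) + 1) := by
      rw [Real.sqrt_le_left (by positivity), mul_pow, Real.sq_sqrt (by positivity)]
      have : (n : ℝ) ≤ 2 * (d + 1) := by exact_mod_cast hn.le
      have : (0 : ℝ) ≤ d := Nat.cast_nonneg d
      linarith
    calc ballCount d n * √n ≤ ballCount (d + 1) n * (2 * √((d : ℝ) + 1)) := by gcongr
      _ = 2 * √((d : ℝ) + 1) * ballCount (d + 1) n := by ring
      _ ≤ _ := by gcongr; linarith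
  · set k := (n / (2 * (d + 1))).sqrt with hkdef
    have hk2 : k ^ 2 * (2 * (d + 1)) ≤ n :=
      (Nat.mul_le_mul_right _ (Nat.sqrt_le' _)).trans (Nat.div_mul_le_self _ _)
    have hshrink : ballCount d n ≤ 15 * Real.exp 3 * ballCount d (n - k ^ 2) := by
      rcases Nat.eq_zero_or_pos d with rfl | hd
      · rw [ballCount_zero, ballCount_zero]; linarith
      · exact ballCount_le_shrink hd (by omega)
          ((Nat.mul_le_mul_left _ (by omega)).trans hk2)
    have hlow : (2 * (k : ℝ) + 1) * ballCount d (n - k ^ 2) ≤ ballCount (d + 1) n := by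
      rw [ballCount_succ]
      have hsub : symmIcc k ⊆ symmIcc n.sqrt := by
        intro j hj
        have : k ≤ n.sqrt := Nat.sqrt_le_sqrt (Nat.div_le_self _ _)
        exact mem_symmIcc.2 ((mem_symmIcc.1 hj).trans this)
      refine le_trans ?_ (Finset.sum_le_sum_of_subset_of_nonneg hsub
        fun j _ _ => (ballCount_pos _ _).le)
      have := Finset.card_nsmul_le_sum (symmIcc k) (fun j : ℤ => ballCount d (n - j.natAbs ^ 2))
        (ballCount d (n - k ^ 2)) fun j hj => ballCount_mono d
          (Nat.sub_le_sub_left (Nat.pow_le_pow_left (mem_symmIcc.1 hj) 2) n)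
      rw [card_symmIcc, nsmul_eq_mul] at this
      exact_mod_cast this
    have hsq : √(n : ℝ) ≤ 2 * √((d : ℝ) + 1) * (2 * k + 1) := by
      have h1 : n < (k + 1) ^ 2 * (2 * (d + 1)) := by
        have := Nat.lt_succ_sqrt' (n / (2 * (d + 1)))
        exact (Nat.div_lt_iff_lt_mul (by omega)).1 this
      have h2 : (n : ℝ) ≤ (k + 1) ^ 2 * (2 * (d + 1)) := by exact_mod_cast h1.le
      rw [Real.sqrt_le_left (by positivity), mul_pow, mul_pow, Real.sq_sqrt (by positivity)]
      refine h2.trans ?_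
      have : ((k : ℝ) + 1) ^ 2 ≤ (2 * k + 1) ^ 2 := by gcongr; linarith [Nat.cast_nonneg (α := ℝ) k]
      nlinarith [sq_nonneg (2 * (k : ℝ) + 1), Nat.cast_nonneg (α := ℝ) d]
    calc ballCount d n * √n
        ≤ 15 * Real.exp 3 * ballCount d (n - k ^ 2) * (2 * √((d : ℝ) + 1) * (2 * k + 1)) := by
          gcongr
          exact mul_nonneg (by positivity) (ballCount_pos _ _).le
      _ = 30 * Real.exp 3 * √((d : ℝ) + 1) * ((2 * k + 1) * ballCount d (n - k ^ 2)) := by ring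
      _ ≤ _ := by gcongr

/-- The closed form of the Dirichlet kernel. -/
lemma sum_cos_symmIcc_mul_sin (L : ℕ) (θ : ℝ) :
    (∑ k ∈ symmIcc L, Real.cos (k * θ)) * Real.sin (θ / 2) = Real.sin ((L + 1 / 2) * θ) := by
  induction L with
  | zero => simp [symmIcc]; ring_nf
  | succ L ih =>
    have : symmIcc (L + 1) = insert (-(L + 1 : ℤ)) (insert (L + 1 : ℤ) (symmIcc L)) := by
      ext k; simp only [Finset.mem_insert, mem_symmIcc]; omega
    rw [this, Finset.sum_insert, Finset.sum_insert, add_mul, add_mul, ih]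
    · push_cast
      rw [show (-((L : ℝ) + 1)) * θ = -(((L : ℝ) + 1) * θ) by ring, Real.cos_neg,
        show ((L : ℝ) + 1 / 2) * θ = ((L : ℝ) + 1) * θ - θ / 2 by ring,
        show ((L : ℝ) + 1 + 1 / 2) * θ = ((L : ℝ) + 1) * θ + θ / 2 by ring,
        Real.sin_add, Real.sin_sub]
      ring
    · simp only [mem_symmIcc]; omega
    · simp only [Finset.mem_insert, mem_symmIcc]; omega

lemma abs_sum_cos_symmIcc_mul_sin_le (L : ℕ) (θ : ℝ) :
    |∑ k ∈ symmIcc L, Real.cos (k * θ)| * |Real.sin (θ / 2)| ≤ 1 := by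
  rw [← abs_mul, sum_cos_symmIcc_mul_sin]
  exact Real.abs_sin_le_one _

/-- Summing an oscillating factor in the first coordinate gains over the trivial bound. -/
lemma abs_sum_cos_mul_tail_le (d n : ℕ) (θ : ℝ) (g : (Fin d → ℤ) → ℝ) (hg : ∀ y, |g y| ≤ 1) :
    |∑ x ∈ latticeBall (d + 1) n, Real.cos (x 0 * θ) * g (Fin.tail x)| * |Real.sin (θ / 2)| ≤
      ballCount d n := by
  rw [sum_latticeBall_succ']
  simp only [Fin.cons_zero, Fin.tail_cons]
  calc _ ≤ (∑ y ∈ latticeBall d n,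
        |∑ k ∈ symmIcc (n - latticeNormSq y).sqrt, Real.cos (k * θ) * g y|) *
          |Real.sin (θ / 2)| := by
        gcongr
        exact Finset.abs_sum_le_sum_abs _ _
    _ ≤ ballCount d n := by
        rw [Finset.sum_mul, ballCount_eq_sum]
        refine Finset.sum_le_sum fun y _ => ?_
        rw [← Finset.sum_mul, abs_mul]
        have h1 := abs_sum_cos_symmIcc_mul_sin_le (n - latticeNormSq y).sqrt θ
        calc _ = (|∑ k ∈ symmIcc (n - latticeNormSq y).sqrt, Real.cos (k * θ)| *
              |Real.sin (θ / 2)|) * |g y| := by ring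
          _ ≤ 1 * 1 := by gcongr; exact hg y
          _ = 1 := one_mul _

/-- The exponential sum over the lattice ball, in its real form. -/
noncomputable def cosSum (d n : ℕ) (φ : Fin d → ℝ) : ℝ :=
  ∑ x ∈ latticeBall d n, ∏ j, Real.cos (x j * φ j)

lemma abs_prod_cos_le_one {d : ℕ} (x : Fin d → ℤ) (φ : Fin d → ℝ) :
    |∏ j, Real.cos (x j * φ j)| ≤ 1 := by
  rw [Finset.abs_prod]
  exact Finset.prod_le_one (fun _ _ => abs_nonneg _) fun _ _ => Real.abs_cos_le_one _

lemma cosSum_perm {d : ℕ} (n : ℕ) (σ : Equiv.Perm (Fin d)) (φ : Fin d → ℝ) :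
    cosSum d n (φ ∘ σ) = cosSum d n φ := by
  rw [cosSum, cosSum, ← sum_latticeBall_perm n σ]
  refine Finset.sum_congr rfl fun x _ => ?_
  exact Equiv.prod_comp σ fun j => Real.cos (x j * φ j)

lemma abs_cosSum_mul_sin_le (d n : ℕ) (φ : Fin (d + 1) → ℝ) (j : Fin (d + 1)) :
    |cosSum (d + 1) n φ| * |Real.sin (φ j / 2)| ≤ ballCount d n := by
  rw [← cosSum_perm n (Equiv.swap 0 j), cosSum]
  have h := abs_sum_cos_mul_tail_le d n (φ j)
    (fun y => ∏ i, Real.cos (y i * Fin.tail (φ ∘ Equiv.swap 0 j) i))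
    fun y => abs_prod_cos_le_one y _
  convert h using 4 with x
  rw [Fin.prod_univ_succ]
  simp [Fin.tail]

lemma abs_cosSum_le (d n : ℕ) (φ : Fin d → ℝ) : |cosSum d n φ| ≤ ballCount d n := by
  rw [ballCount_eq_sum]
  exact (Finset.abs_sum_le_sum_abs _ _).trans
    (Finset.sum_le_sum fun x _ => abs_prod_cos_le_one x φ)

lemma abs_sin_natCast_mul_le (m : ℕ) (α : ℝ) : |Real.sin (m * α)| ≤ m * |Real.sin α| := by
  induction m with
  | zero => simp
  | succ m ih =>
    have : ((m + 1 : ℕ) : ℝ) * α = m * α + α := by push_cast; ring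
    rw [this, Real.sin_add]
    refine (abs_add_le _ _).trans ?_
    rw [abs_mul, abs_mul]
    have h1 := Real.abs_cos_le_one α
    have h2 := Real.abs_cos_le_one (m * α)
    push_cast
    nlinarith [abs_nonneg (Real.sin α), abs_nonneg (Real.sin (m * α)), abs_nonneg (Real.cos α),
      abs_nonneg (Real.cos (m * α))]

lemma one_sub_cos_eq (α : ℝ) : 1 - Real.cos α = 2 * Real.sin (α / 2) ^ 2 := by
  have h : Real.cos α = Real.cos (2 * (α / 2)) := by ring_nf
  rw [h, Real.cos_two_mul, Real.sin_sq]
  ring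

lemma one_sub_cos_natCast_mul_le (m : ℕ) (α : ℝ) :
    1 - Real.cos (m * α) ≤ (m : ℝ) ^ 2 * (1 - Real.cos α) := by
  rw [one_sub_cos_eq, one_sub_cos_eq]
  have h := abs_sin_natCast_mul_le m (α / 2)
  have h2 := pow_le_pow_left₀ (abs_nonneg _) h 2
  rw [sq_abs, mul_pow, sq_abs, ← mul_div_assoc] at h2
  linarith

lemma one_sub_cos_intCast_mul_le (k : ℤ) (α : ℝ) :
    1 - Real.cos (k * α) ≤ (k : ℝ) ^ 2 * (1 - Real.cos α) := by
  obtain ⟨m, rfl | rfl⟩ := Int.eq_nat_or_neg k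
  · exact_mod_cast one_sub_cos_natCast_mul_le m α
  · have := one_sub_cos_natCast_mul_le m α
    push_cast
    rw [neg_mul, Real.cos_neg, neg_sq]
    exact this

lemma abs_cos_le (α : ℝ) : |Real.cos α| ≤ 1 - (1 - Real.cos (2 * α)) / 4 := by
  rw [Real.cos_two_mul, abs_le]
  constructor <;> nlinarith [sq_nonneg (Real.cos α - 1), sq_nonneg (Real.cos α + 1)]

/-- An angle with nonnegative cosine is equivalent to one in `[0, π / 2]`. -/
lemma exists_reduced_angle (φ : ℝ) (h : 0 ≤ Real.cos φ) :
    ∃ ψ : ℝ, 0 ≤ ψ ∧ ψ ≤ Real.pi / 2 ∧ ∀ k : ℤ, Real.cos (k * φ) = Real.cos (k * ψ) := by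
  have hpi := Real.pi_pos
  set q := round (φ / (2 * Real.pi))
  set φ' := φ - q * (2 * Real.pi) with hφ'
  have hcos : ∀ k : ℤ, Real.cos (k * φ) = Real.cos (k * φ') := by
    intro k
    rw [hφ', mul_sub, ← mul_assoc, ← Int.cast_mul, Real.cos_sub_int_mul_two_pi]
  have habs : |φ'| ≤ Real.pi := by
    have h1 := abs_sub_round (φ / (2 * Real.pi))
    have h2 : φ' = (φ / (2 * Real.pi) - q) * (2 * Real.pi) := by
      rw [hφ']; field_simp
    rw [h2, abs_mul, abs_of_pos (by positivity : 0 < 2 * Real.pi)]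
    nlinarith
  refine ⟨|φ'|, abs_nonneg _, ?_, fun k => ?_⟩
  · by_contra hlt
    push Not at hlt
    have h1 := Real.cos_neg_of_pi_div_two_lt_of_lt hlt (by linarith)
    rw [Real.cos_abs] at h1
    have h2 := hcos 1
    simp only [Int.cast_one, one_mul] at h2
    linarith
  · rw [hcos k]
    rcases abs_cases φ' with h | h <;> rw [h.1]
    rw [mul_neg, Real.cos_neg]

/-- Contraction factor of the average of `|cos|` over the first coordinate. -/
lemma exists_sum_abs_cos_le : ∃ c K : ℝ, 0 < c ∧ c ≤ 1 ∧ 1 ≤ K ∧ ∀ (d n : ℕ) (φ : ℝ),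
    0 ≤ Real.cos φ → K * (d + 1) ≤ n →
    ∑ x ∈ latticeBall (d + 1) n, |Real.cos (x 0 * φ)| ≤
      (1 - c * min 1 (n / (d + 1) * Real.sin (φ / 2) ^ 2)) * ballCount (d + 1) n := by
  obtain ⟨C, hC1, hC⟩ := exists_ballCount_slice_le
  have hC0 : 0 < C := by linarith
  have hpi := Real.pi_pos
  have hpi3 := Real.pi_gt_three
  have hA : (1 : ℝ) ≤ (Real.pi * C) ^ 2 := one_le_pow₀ (by nlinarith)
  refine ⟨1 / (8 * (Real.pi * C) ^ 2), (4 * C) ^ 2, by positivity, ?_, by nlinarith, ?_⟩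
  · rw [div_le_one (by positivity)]; linarith
  intro d n φ hφ hn
  obtain ⟨ψ, hψ0, hψ1, hψ⟩ := exists_reduced_angle φ hφ
  have hG := ballCount_pos (d + 1) n
  have hd : (0 : ℝ) < d + 1 := by positivity
  have hn0 : (0 : ℝ) < n := lt_of_lt_of_le (by positivity) hn
  have hsin : Real.sin (φ / 2) ^ 2 = Real.sin (ψ / 2) ^ 2 := by
    have := hψ 1
    simp only [Int.cast_one, one_mul] at this
    have h1 := one_sub_cos_eq φ
    have h2 := one_sub_cos_eq ψ
    linarith
  rw [hsin]
  simp_rw [hψ]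
  rcases hψ0.eq_or_lt with rfl | hψ0
  · simp [ballCount]
  set κ := √n / √((d : ℝ) + 1) with hκ
  have hκ2 : κ ^ 2 = n / (d + 1) := by
    rw [hκ, div_pow, Real.sq_sqrt hn0.le, Real.sq_sqrt hd.le]
  have hκ0 : 0 < κ := by positivity
  have hκC : 4 * C ≤ κ := by
    have : (4 * C) ^ 2 ≤ κ ^ 2 := by rw [hκ2, le_div_iff₀ hd]; exact hn
    exact le_of_sq_le_sq this hκ0.le
  set τ := 2 * C / κ with hτ
  have hτ0 : 0 < τ := by positivity
  have hτ1 : τ ≤ 1 / 2 := by rw [hτ, div_le_iff₀ hκ0]; linarith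
  have hslice : ballCount d n ≤ τ / 2 * ballCount (d + 1) n := by
    have h1 := hC d n
    have : τ / 2 = C * √((d : ℝ) + 1) / √n := by
      rw [hτ, hκ]; field_simp
    rw [this, div_mul_eq_mul_div, le_div_iff₀ (by positivity)]
    exact h1
  obtain ⟨m, hm0, hmsin, hm⟩ : ∃ m : ℕ, 0 < m ∧ τ ≤ |Real.sin (m * ψ)| ∧
      min 1 (ψ ^ 2 / (Real.pi * τ) ^ 2) ≤ 1 / (m : ℝ) ^ 2 := by
    rcases le_or_gt (Real.pi / 2 * τ) ψ with h | h
    · refine ⟨1, one_pos, ?_, by simp⟩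
      have := Real.mul_le_sin hψ0.le hψ1
      rw [Nat.cast_one, one_mul]
      refine le_trans ?_ (le_abs_self _)
      refine le_trans ?_ this
      rw [div_mul_eq_mul_div, le_div_iff₀ hpi]
      linarith
    · set m := ⌈Real.pi / 2 * τ / ψ⌉₊
      have hm1 : Real.pi / 2 * τ / ψ ≤ m := Nat.le_ceil _
      have hm2 : (m : ℝ) < Real.pi / 2 * τ / ψ + 1 := Nat.ceil_lt_add_one (by positivity)
      rw [div_le_iff₀ hψ0] at hm1
      have hm3 : (m : ℝ) * ψ < Real.pi * τ := by
        have := mul_lt_mul_of_pos_right hm2 hψ0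
        rw [add_mul, div_mul_cancel₀ _ hψ0.ne'] at this
        linarith
      have hmpos : 0 < m := Nat.ceil_pos.2 (by positivity)
      have hmpos' : (0 : ℝ) < m := by exact_mod_cast hmpos
      refine ⟨m, hmpos, ?_, (min_le_right _ _).trans ?_⟩
      · have h2 := Real.mul_le_sin (x := m * ψ) (by positivity) (by nlinarith)
        refine le_trans (le_trans ?_ h2) (le_abs_self _)
        rw [div_mul_eq_mul_div, le_div_iff₀ hpi]
        linarith
      · rw [div_le_div_iff₀ (by positivity) (by positivity), one_mul, ← mul_pow]
        exact pow_le_pow_left₀ (by positivity) (by linarith) 2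
  have hm0' : (0 : ℝ) < m := by exact_mod_cast hm0
  have hE : |∑ x ∈ latticeBall (d + 1) n, Real.cos (x 0 * (2 * (m * ψ)))| ≤
      ballCount (d + 1) n / 2 := by
    have h := abs_sum_cos_mul_tail_le d n (2 * (m * ψ)) (fun _ => 1) (by simp)
    simp only [mul_one] at h
    rw [mul_div_cancel_left₀ _ (two_ne_zero' ℝ)] at h
    have h2 := (mul_le_mul_of_nonneg_left hmsin (abs_nonneg _)).trans (h.trans hslice)
    have h3 : |∑ x ∈ latticeBall (d + 1) n, Real.cos (x 0 * (2 * (m * ψ)))| * τ ≤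
        ballCount (d + 1) n / 2 * τ := by linarith
    exact le_of_mul_le_mul_right h3 hτ0
  have hlow : ballCount (d + 1) n / 2 ≤
      (m : ℝ) ^ 2 * ∑ x ∈ latticeBall (d + 1) n, (1 - Real.cos (2 * (x 0 * ψ))) := by
    calc ballCount (d + 1) n / 2
        ≤ ∑ x ∈ latticeBall (d + 1) n, (1 - Real.cos (x 0 * (2 * (m * ψ)))) := by
          rw [Finset.sum_sub_distrib, ← ballCount_eq_sum]
          linarith [(abs_le.1 hE).2]
      _ ≤ _ := by
          rw [Finset.mul_sum]
          refine Finset.sum_le_sum fun x _ => ?_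
          have := one_sub_cos_natCast_mul_le m (2 * (x 0 * ψ))
          rwa [show (m : ℝ) * (2 * (x 0 * ψ)) = x 0 * (2 * (m * ψ)) by ring] at this
  have hmin : 1 / (8 * (Real.pi * C) ^ 2) * min 1 (n / (d + 1) * Real.sin (ψ / 2) ^ 2) ≤
      1 / (8 * (m : ℝ) ^ 2) := by
    have h1 : Real.sin (ψ / 2) ^ 2 ≤ (ψ / 2) ^ 2 :=
      pow_le_pow_left₀ (Real.sin_nonneg_of_nonneg_of_le_pi (by linarith) (by linarith))
        (Real.sin_le (by linarith)) 2
    have h2 : 1 / (Real.pi * C) ^ 2 * min 1 (n / (d + 1) * Real.sin (ψ / 2) ^ 2) ≤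
        min 1 (ψ ^ 2 / (Real.pi * τ) ^ 2) := by
      refine le_min ?_ ?_
      · calc _ ≤ 1 / (Real.pi * C) ^ 2 * 1 := by gcongr; exact min_le_left _ _
          _ ≤ 1 := by rw [mul_one, div_le_one (by positivity)]; exact hA
      · calc _ ≤ 1 / (Real.pi * C) ^ 2 * (κ ^ 2 * (ψ / 2) ^ 2) := by
              gcongr
              rw [hκ2]
              exact (min_le_right _ _).trans (by gcongr)
          _ = ψ ^ 2 / (Real.pi * τ) ^ 2 := by rw [hτ]; field_simp
    calc _ = 1 / 8 * (1 / (Real.pi * C) ^ 2 * min 1 (n / (d + 1) * Real.sin (ψ / 2) ^ 2)) := by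
          field_simp
      _ ≤ 1 / 8 * (1 / (m : ℝ) ^ 2) := by gcongr; exact h2.trans hm
      _ = _ := by field_simp
  calc ∑ x ∈ latticeBall (d + 1) n, |Real.cos (x 0 * ψ)|
      ≤ ∑ x ∈ latticeBall (d + 1) n, (1 - (1 - Real.cos (2 * (x 0 * ψ))) / 4) :=
        Finset.sum_le_sum fun x _ => abs_cos_le _
    _ = ballCount (d + 1) n -
        (∑ x ∈ latticeBall (d + 1) n, (1 - Real.cos (2 * (x 0 * ψ)))) / 4 := by
        rw [Finset.sum_sub_distrib, ← ballCount_eq_sum, ← Finset.sum_div]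
    _ ≤ (1 - 1 / (8 * (m : ℝ) ^ 2)) * ballCount (d + 1) n := by
        have : 1 / (8 * (m : ℝ) ^ 2) * ballCount (d + 1) n ≤
            (∑ x ∈ latticeBall (d + 1) n, (1 - Real.cos (2 * (x 0 * ψ)))) / 4 := by
          rw [div_mul_eq_mul_div, one_mul, div_le_iff₀ (by positivity)]
          linarith
        linarith
    _ ≤ _ := by gcongr

/-- A product bound for sums over the part of the ball where the first `m` coordinates leave at
least `r` of the squared radius unused. -/
lemma sum_prefix_weight_le (r D m : ℕ) : ∀ (d n : ℕ) (w : Fin d → ℤ → ℝ) (ρ : Fin d → ℝ),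
    d ≤ D → (∀ j k, 0 ≤ w j k) → (∀ j, 0 ≤ ρ j) →
    (∀ j d' n', d' + 1 ≤ D → r ≤ n' →
      ∑ k ∈ symmIcc n'.sqrt, w j k * ballCount d' (n' - k.natAbs ^ 2) ≤
        ρ j * ballCount (d' + 1) n') →
    ∑ x ∈ latticeBall d n,
      (if r + ∑ j, (if j.val < m then (x j).natAbs ^ 2 else 0) ≤ n then
        ∏ j, (if j.val < m then w j (x j) else 1) else 0) ≤
      (∏ j, if j.val < m then ρ j else 1) * ballCount d n := by
  induction m with
  | zero =>
    intro d n w ρ _ _ _ _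
    simp only [Nat.not_lt_zero, if_false, Finset.prod_const_one, one_mul, ballCount_eq_sum]
    refine Finset.sum_le_sum fun x _ => ?_
    split_ifs <;> norm_num
  | succ m ih =>
    intro d n w ρ hd hw hρ h
    cases d with
    | zero =>
      simp only [Finset.univ_eq_empty, Finset.prod_empty, one_mul, ballCount_eq_sum]
      refine Finset.sum_le_sum fun x _ => ?_
      split_ifs <;> norm_num
    | succ d =>
      rcases Nat.lt_or_ge n r with hn | hn
      · rw [Finset.sum_eq_zero fun x _ => if_neg (by omega)]
        refine mul_nonneg (Finset.prod_nonneg fun j _ => ?_) (ballCount_pos _ _).le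
        split_ifs
        exacts [hρ j, zero_le_one]
      · set P := ∏ j : Fin d, if j.val < m then ρ j.succ else 1 with hP
        have hP0 : 0 ≤ P := Finset.prod_nonneg fun j _ => by
          split_ifs
          exacts [hρ _, zero_le_one]
        rw [sum_latticeBall_succ, Fin.prod_univ_succ]
        simp only [Fin.sum_univ_succ, Fin.prod_univ_succ, Fin.cons_zero, Fin.cons_succ,
          Fin.val_zero, Nat.succ_pos, if_true, Fin.val_succ, Nat.succ_lt_succ_iff]
        rw [← hP]
        calc _ ≤ ∑ k ∈ symmIcc n.sqrt, w 0 k * (P * ballCount d (n - k.natAbs ^ 2)) := by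
              refine Finset.sum_le_sum fun k hk => ?_
              have hk' : k.natAbs ^ 2 ≤ n := Nat.le_sqrt'.1 (mem_symmIcc.1 hk)
              refine le_trans (le_of_eq ?_) (mul_le_mul_of_nonneg_left
                (ih d (n - k.natAbs ^ 2) (fun j => w j.succ) (fun j => ρ j.succ) (by omega)
                  (fun j => hw _) (fun j => hρ _) fun j => h _) (hw 0 k))
              rw [Finset.mul_sum]
              refine Finset.sum_congr rfl fun y _ => ?_
              rw [mul_ite, mul_zero]
              refine if_congr ?_ rfl rfl
              omega
          _ = P * ∑ k ∈ symmIcc n.sqrt, w 0 k * ballCount d (n - k.natAbs ^ 2) := by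
              rw [Finset.mul_sum]
              exact Finset.sum_congr rfl fun k _ => by ring
          _ ≤ P * (ρ 0 * ballCount (d + 1) n) :=
              mul_le_mul_of_nonneg_left (h 0 d n hd hn) hP0
          _ = _ := by ring

/-- Exponential decay of the exponential sum over the part of the ball where the first `m`
coordinates carry at most half of the squared radius. -/
lemma exists_sum_prefix_cos_le : ∃ c K : ℝ, 0 < c ∧ 1 ≤ K ∧ ∀ (d n m : ℕ) (φ : Fin d → ℝ),
    1 ≤ d → (∀ j, 0 ≤ Real.cos (φ j)) → K * d ≤ n →
    ∑ x ∈ latticeBall d n,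
      (if n / 2 + ∑ j, (if j.val < m then (x j).natAbs ^ 2 else 0) ≤ n then
        ∏ j, (if j.val < m then |Real.cos (x j * φ j)| else 1) else 0) ≤
      Real.exp (-c * ∑ j, if j.val < m then min 1 (n / d * Real.sin (φ j / 2) ^ 2) else 0) *
        ballCount d n := by
  obtain ⟨c, K, hc, hc1, hK, H⟩ := exists_sum_abs_cos_le
  refine ⟨c / 4, 4 * K, by positivity, by linarith, fun d n m φ hd hφ hn => ?_⟩
  have hd0 : (1 : ℝ) ≤ d := by exact_mod_cast hd
  set b : Fin d → ℝ := fun j => min 1 (n / d * Real.sin (φ j / 2) ^ 2) with hb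
  have hb0 : ∀ j, 0 ≤ b j := fun j => le_min zero_le_one (by positivity)
  have hb1 : ∀ j, b j ≤ 1 := fun j => min_le_left _ _
  have key := sum_prefix_weight_le (n / 2) d m d n (fun j k => |Real.cos (k * φ j)|)
    (fun j => 1 - c / 4 * b j) le_rfl (fun _ _ => abs_nonneg _)
    (fun j => by nlinarith [hb0 j, hb1 j]) fun j d' n' hd' hn' => ?_
  · refine key.trans (mul_le_mul_of_nonneg_right ?_ (ballCount_pos _ _).le)
    rw [Finset.mul_sum, Real.exp_sum]
    refine Finset.prod_le_prod (fun j _ => ?_) fun j _ => ?_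
    · split_ifs
      exacts [by nlinarith [hb0 j, hb1 j], zero_le_one]
    · split_ifs
      · have := Real.add_one_le_exp (-(c / 4) * b j)
        linarith
      · simp
  · have hn4 : (n : ℝ) ≤ 4 * n' := by
      have h2 : 2 ≤ n := by
        have : (2 : ℝ) ≤ n := by nlinarith
        exact_mod_cast this
      exact_mod_cast (by omega : n ≤ 4 * n')
    have hd'' : (d' : ℝ) + 1 ≤ d := by exact_mod_cast hd'
    have h := H d' n' (φ j) (hφ j) (by nlinarith)
    rw [sum_latticeBall_succ] at h
    simp only [Fin.cons_zero, Finset.sum_const, nsmul_eq_mul] at h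
    have hbmin : b j / 4 ≤ min 1 (n' / (d' + 1) * Real.sin (φ j / 2) ^ 2) := by
      refine le_min (by linarith [hb1 j]) ?_
      have h1 : (n : ℝ) / d ≤ 4 * (n' / (d' + 1)) := by
        rw [← mul_div_assoc]
        gcongr
      have h2 : b j ≤ n / d * Real.sin (φ j / 2) ^ 2 := min_le_right _ _
      nlinarith [sq_nonneg (Real.sin (φ j / 2))]
    calc _ ≤ _ := le_of_eq (Finset.sum_congr rfl fun k _ => mul_comm _ _)
      _ ≤ _ := h
      _ ≤ _ := by
        refine mul_le_mul_of_nonneg_right ?_ (ballCount_pos _ _).le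
        nlinarith

/-- Exponential decay of the exponential sum over the ball, when no frequency is close to `π`. -/
lemma exists_abs_cosSum_le_exp : ∃ c K A : ℝ, 0 < c ∧ 1 ≤ K ∧ 0 < A ∧
    ∀ (d n : ℕ) (φ : Fin d → ℝ), 1 ≤ d → (∀ j, 0 ≤ Real.cos (φ j)) → K * d ≤ n →
    |cosSum d n φ| ≤ A * Real.exp (-c * ∑ j, min 1 (n / d * Real.sin (φ j / 2) ^ 2)) *
      ballCount d n := by
  obtain ⟨c, K, hc, hK, H⟩ := exists_sum_prefix_cos_le
  refine ⟨c / 2, K, 2 * Real.exp c, by positivity, hK, by positivity, fun d n φ hd hφ hn => ?_⟩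
  set b : Fin d → ℝ := fun j => min 1 (n / d * Real.sin (φ j / 2) ^ 2) with hb
  have hb0 : ∀ j, 0 ≤ b j := fun j => le_min zero_le_one (by positivity)
  have hb1 : ∀ j, b j ≤ 1 := fun j => min_le_left _ _
  set B := ∑ j, b j with hB
  set p : ℕ → ℝ := fun m => ∑ j : Fin d, if j.val < m then b j else 0 with hp
  have hB0 : 0 ≤ B := Finset.sum_nonneg fun j _ => hb0 j
  have hpd : p d = B := Finset.sum_congr rfl fun j _ => if_pos j.2
  have hp_succ : ∀ m, p (m + 1) ≤ p m + 1 := by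
    intro m
    have : p (m + 1) = p m + ∑ j : Fin d, if j.val = m then b j else 0 := by
      rw [hp, ← Finset.sum_add_distrib]
      refine Finset.sum_congr rfl fun j _ => ?_
      by_cases h1 : j.val < m
      · rw [if_pos h1, if_pos (by omega), if_neg (by omega), add_zero]
      · by_cases h2 : j.val = m
        · rw [if_neg h1, if_pos (by omega), if_pos h2, zero_add]
        · rw [if_neg h1, if_neg (by omega), if_neg h2, zero_add]
    rw [this]
    refine add_le_add_right ?_ _
    by_cases hm : m < d
    · rw [Finset.sum_eq_single ⟨m, hm⟩ (fun j _ hj => if_neg fun h => hj (Fin.ext h)) (by simp)]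
      simpa using hb1 _
    · rw [Finset.sum_eq_zero fun j _ => if_neg (by have := j.2; omega)]
      exact zero_le_one
  obtain ⟨m, hm1, hm2⟩ : ∃ m, B / 2 ≤ p m ∧ p m ≤ B / 2 + 1 := by
    have hex : ∃ m, B / 2 ≤ p m := ⟨d, by rw [hpd]; linarith⟩
    classical
    refine ⟨Nat.find hex, Nat.find_spec hex, ?_⟩
    rcases hfind : Nat.find hex with _ | k
    · have : p 0 = 0 := by simp [hp]
      rw [this]; linarith
    · have := Nat.find_min hex (m := k) (by omega)
      linarith [hp_succ k]
  have hG := ballCount_pos d n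
  have hpre := H d n m φ hd hφ hn
  have hsuf := H d n (d - m) (φ ∘ Fin.rev) hd (fun j => hφ _) hn
  have hrev : ∑ j : Fin d, (if j.val < d - m then min 1 (n / d * Real.sin ((φ ∘ Fin.rev) j / 2) ^ 2)
      else 0) = B - p m := by
    rw [eq_sub_iff_add_eq, hB, hp]
    dsimp only
    rw [← Equiv.sum_comp Fin.revPerm, ← Finset.sum_add_distrib]
    refine Finset.sum_congr rfl fun j _ => ?_
    have hj := j.2
    simp only [Fin.revPerm_apply, Fin.val_rev, Function.comp, Fin.rev_rev]
    by_cases h : j.val < m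
    · rw [if_neg (by omega), if_pos h, zero_add]
    · rw [if_pos (by omega), if_neg h, add_zero]
  rw [hrev, ← sum_latticeBall_perm n Fin.revPerm] at hsuf
  have hcover : |cosSum d n φ| ≤ ∑ x ∈ latticeBall d n,
      ((if n / 2 + ∑ j, (if j.val < m then (x j).natAbs ^ 2 else 0) ≤ n then
        ∏ j, (if j.val < m then |Real.cos (x j * φ j)| else 1) else 0) +
      (if n / 2 + ∑ j : Fin d, (if j.val < d - m then ((x ∘ Fin.revPerm) j).natAbs ^ 2 else 0) ≤ n
        then ∏ j : Fin d, (if j.val < d - m then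
          |Real.cos ((x ∘ Fin.revPerm) j * (φ ∘ Fin.rev) j)| else 1) else 0)) := by
    refine (Finset.abs_sum_le_sum_abs _ _).trans (Finset.sum_le_sum fun x hx => ?_)
    have hx := mem_latticeBall.1 hx
    rw [Finset.abs_prod]
    have hnn1 : ∀ j : Fin d, (0 : ℝ) ≤ if j.val < m then |Real.cos (x j * φ j)| else 1 :=
      fun j => by split_ifs <;> positivity
    have hnn2 : ∀ j : Fin d, (0 : ℝ) ≤ if j.val < d - m then
        |Real.cos ((x ∘ Fin.revPerm) j * (φ ∘ Fin.rev) j)| else 1 :=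
      fun j => by split_ifs <;> positivity
    have hsplit : latticeNormSq x = ∑ j, (if j.val < m then (x j).natAbs ^ 2 else 0) +
        ∑ j : Fin d, (if j.val < d - m then ((x ∘ Fin.revPerm) j).natAbs ^ 2 else 0) := by
      rw [← Equiv.sum_comp Fin.revPerm fun j : Fin d =>
        (if j.val < d - m then ((x ∘ Fin.revPerm) j).natAbs ^ 2 else 0),
        ← Finset.sum_add_distrib, latticeNormSq]
      refine Finset.sum_congr rfl fun j _ => ?_
      have hj := j.2
      simp only [Fin.revPerm_apply, Fin.val_rev, Function.comp, Fin.rev_rev]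
      by_cases h : j.val < m
      · rw [if_pos h, if_neg (by omega), add_zero]
      · rw [if_neg h, if_pos (by omega), zero_add]
    by_cases h1 : n / 2 + ∑ j, (if j.val < m then (x j).natAbs ^ 2 else 0) ≤ n
    · rw [if_pos h1]
      refine le_add_of_le_of_nonneg (Finset.prod_le_prod (fun _ _ => abs_nonneg _) fun j _ => ?_) ?_
      · split_ifs
        exacts [le_rfl, Real.abs_cos_le_one _]
      · split_ifs
        exacts [Finset.prod_nonneg fun j _ => hnn2 j, le_rfl]
    · rw [if_neg h1, zero_add, if_pos (by omega), ← Equiv.prod_comp Fin.revPerm]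
      refine Finset.prod_le_prod (fun _ _ => abs_nonneg _) fun j _ => ?_
      split_ifs
      exacts [le_rfl, Real.abs_cos_le_one _]
  rw [Finset.sum_add_distrib] at hcover
  have e1 : Real.exp (-c * p m) ≤ Real.exp c * Real.exp (-(c / 2) * B) := by
    rw [← Real.exp_add]
    exact Real.exp_le_exp.2 (by nlinarith)
  have e2 : Real.exp (-c * (B - p m)) ≤ Real.exp c * Real.exp (-(c / 2) * B) := by
    rw [← Real.exp_add]
    exact Real.exp_le_exp.2 (by nlinarith)
  calc |cosSum d n φ| ≤ _ := hcover
    _ ≤ Real.exp (-c * p m) * ballCount d n + Real.exp (-c * (B - p m)) * ballCount d n :=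
        add_le_add hpre hsuf
    _ ≤ Real.exp c * Real.exp (-(c / 2) * B) * ballCount d n +
        Real.exp c * Real.exp (-(c / 2) * B) * ballCount d n := by gcongr
    _ = _ := by ring

/-- A single frequency controls the exponential sum over the ball. -/
lemma exists_cosSum_sq_mul_sin_sq_le : ∃ C : ℝ, 0 < C ∧ ∀ (d n : ℕ) (φ : Fin d → ℝ) (j : Fin d),
    (cosSum d n φ / ballCount d n) ^ 2 * (n / d * Real.sin (φ j / 2) ^ 2) ≤ C := by
  obtain ⟨C, hC1, hC⟩ := exists_ballCount_slice_le
  refine ⟨C ^ 2, by positivity, fun d n φ j => ?_⟩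
  obtain ⟨d, rfl⟩ : ∃ e, d = e + 1 := ⟨d - 1, by have := j.2; omega⟩
  have hG := ballCount_pos (d + 1) n
  have h1 := abs_cosSum_mul_sin_le d n φ j
  have h2 := (mul_le_mul_of_nonneg_right h1 (Real.sqrt_nonneg n)).trans (hC d n)
  have h3 := pow_le_pow_left₀ (by positivity) h2 2
  rw [mul_pow, mul_pow, sq_abs, sq_abs, mul_pow, mul_pow, Real.sq_sqrt (by positivity),
    Real.sq_sqrt (by positivity)] at h3
  rw [div_pow, div_mul_eq_mul_div, div_mul_eq_mul_div, ← mul_div_assoc, div_div,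
    div_le_iff₀ (by positivity)]
  push_cast
  linarith

lemma abs_cosSum_div_le_one (d n : ℕ) (φ : Fin d → ℝ) : |cosSum d n φ / ballCount d n| ≤ 1 := by
  have hG := ballCount_pos d n
  rw [abs_div, abs_of_pos hG, div_le_one hG]
  exact abs_cosSum_le d n φ

/-- Decay of the multiplier of the ball averages, uniformly in the dimension. -/
lemma exists_multiplier_sq_le : ∃ C : ℝ, 0 < C ∧ ∀ (d n : ℕ) (φ : Fin d → ℝ), 1 ≤ d → 1 ≤ n →
    0 < ∑ j, Real.sin (φ j / 2) ^ 2 →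
    (cosSum d n φ / ballCount d n) ^ 2 ≤
      C * (1 / √(n / d * ∑ j, Real.sin (φ j / 2) ^ 2) + d / n) := by
  obtain ⟨C, hC, HC⟩ := exists_cosSum_sq_mul_sin_sq_le
  obtain ⟨c, K, A, hc, hK, hA, HE⟩ := exists_abs_cosSum_le_exp
  refine ⟨1 + K + 2 * C + A / c, by positivity, fun d n φ hd hn hs => ?_⟩
  have hd0 : (0 : ℝ) < d := by exact_mod_cast hd
  have hn0 : (0 : ℝ) < n := by exact_mod_cast hn
  have hG := ballCount_pos d n
  set s := ∑ j, Real.sin (φ j / 2) ^ 2 with hsdef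
  set Y := √(n / d * s) with hY
  have hY2 : Y ^ 2 = n / d * s := Real.sq_sqrt (by positivity)
  have hY0 : 0 < Y := Real.sqrt_pos.2 (by positivity)
  set r := cosSum d n φ / ballCount d n with hr
  have hr1 : |r| ≤ 1 := abs_cosSum_div_le_one d n φ
  have hr2 : r ^ 2 ≤ |r| := by
    rw [← sq_abs]
    nlinarith [abs_nonneg r]
  have hAc : 0 < A / c := by positivity
  have hdn : 0 < (d : ℝ) / n := by positivity
  have hYi : 0 < 1 / Y := by positivity
  have fin1 : ∀ T, 0 ≤ T → T ≤ 1 + K + 2 * C + A / c → r ^ 2 ≤ T * (1 / Y) →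
      r ^ 2 ≤ (1 + K + 2 * C + A / c) * (1 / Y + d / n) := by
    intro T hT0 hT h
    refine h.trans (mul_le_mul hT (by linarith) hYi.le (by positivity))
  have fin2 : ∀ T, 0 ≤ T → T ≤ 1 + K + 2 * C + A / c → r ^ 2 ≤ T * (d / n) →
      r ^ 2 ≤ (1 + K + 2 * C + A / c) * (1 / Y + d / n) := by
    intro T hT0 hT h
    refine h.trans (mul_le_mul hT (by linarith) hdn.le (by positivity))
  rcases lt_or_ge (n : ℝ) (K * d) with h1 | h1
  · refine fin2 K (by linarith) (by linarith) ((hr2.trans hr1).trans ?_)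
    rw [← mul_div_assoc, le_div_iff₀ hn0]
    linarith
  by_cases h2 : ∀ j, 0 ≤ Real.cos (φ j)
  swap
  · push Not at h2
    obtain ⟨j, hj⟩ := h2
    have h3 := one_sub_cos_eq (φ j)
    have h4 := HC d n φ j
    refine fin2 (2 * C) (by linarith) (by linarith) ?_
    rw [← mul_div_assoc, le_div_iff₀ hn0]
    have h5 : r ^ 2 * (n / d * (1 / 2)) ≤ C := by
      refine le_trans ?_ h4
      gcongr
      linarith
    have h6 := mul_le_mul_of_nonneg_right h5 hd0.le
    have h7 : r ^ 2 * (n / d * (1 / 2)) * d = r ^ 2 * n / 2 := by field_simp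
    linarith
  by_cases h3 : ∃ j, Y ≤ n / d * Real.sin (φ j / 2) ^ 2
  · obtain ⟨j, hj⟩ := h3
    refine fin1 C hC.le (by linarith) ?_
    rw [mul_one_div, le_div_iff₀ hY0]
    exact (mul_le_mul_of_nonneg_left hj (sq_nonneg r)).trans (HC d n φ j)
  push Not at h3
  rcases le_or_gt Y 1 with h4 | h4
  · refine fin1 1 zero_le_one (by linarith) ((hr2.trans hr1).trans ?_)
    rw [one_mul, le_div_iff₀ hY0]
    linarith
  · have hB : Y ≤ ∑ j, min 1 (n / d * Real.sin (φ j / 2) ^ 2) := by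
      have h5 : ∀ j, n / d * Real.sin (φ j / 2) ^ 2 / Y ≤
          min 1 (n / d * Real.sin (φ j / 2) ^ 2) := fun j =>
        le_min ((div_le_one hY0).2 (h3 j).le) (div_le_self (by positivity) h4.le)
      refine le_trans (le_of_eq ?_) (Finset.sum_le_sum fun j _ => h5 j)
      rw [← Finset.sum_div, ← Finset.mul_sum, ← hY2]
      field_simp
    have h5 := HE d n φ hd h2 h1
    have h6 : |r| ≤ A * Real.exp (-c * Y) := by
      rw [hr, abs_div, abs_of_pos hG, div_le_iff₀ hG]
      refine h5.trans ?_
      gcongr ?_ * _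
      refine mul_le_mul_of_nonneg_left (Real.exp_le_exp.2 ?_) hA.le
      nlinarith
    refine fin1 (A / c) hAc.le (by linarith) (hr2.trans (h6.trans ?_))
    have h7 := Real.add_one_le_exp (c * Y)
    have h8 : Real.exp (-c * Y) ≤ 1 / (c * Y) := by
      rw [neg_mul, Real.exp_neg, ← one_div]
      exact one_div_le_one_div_of_le (by positivity) (by linarith)
    calc A * Real.exp (-c * Y) ≤ A * (1 / (c * Y)) := by gcongr
      _ = _ := by field_simp

lemma one_sub_prod_le_sum {ι : Type*} (t : Finset ι) (a : ι → ℝ) (ha : ∀ i, |a i| ≤ 1) :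
    1 - ∏ i ∈ t, a i ≤ ∑ i ∈ t, (1 - a i) := by
  classical
  induction t using Finset.induction_on with
  | empty => simp
  | insert i t hi ih =>
    rw [Finset.prod_insert hi, Finset.sum_insert hi]
    have h1 : |∏ i ∈ t, a i| ≤ 1 := by
      rw [Finset.abs_prod]
      exact Finset.prod_le_one (fun _ _ => abs_nonneg _) fun i _ => ha i
    nlinarith [(abs_le.1 h1).2, (abs_le.1 (ha i)).2]

lemma coordSqSum_le (d n : ℕ) :
    coordSqSum d n ≤ n / (d + 1 : ℕ) * ballCount (d + 1) n := by
  have h := succ_mul_coordSqSum_eq d n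
  have := cumCount_nonneg (d + 1) n
  rw [div_mul_eq_mul_div, le_div_iff₀ (by positivity)]
  push_cast
  linarith

/-- The multiplier of the ball averages is close to `1` near the origin. -/
lemma abs_multiplier_sub_one_le (d n : ℕ) (φ : Fin d → ℝ) :
    |cosSum d n φ / ballCount d n - 1| ≤ 2 * (n / d * ∑ j, Real.sin (φ j / 2) ^ 2) := by
  have hG := ballCount_pos d n
  rw [abs_sub_comm, abs_of_nonneg (sub_nonneg.2 (abs_le.1 (abs_cosSum_div_le_one d n φ)).2)]
  have h1 : ballCount d n - cosSum d n φ ≤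
      ∑ j, 2 * Real.sin (φ j / 2) ^ 2 * (n / d * ballCount d n) := by
    calc ballCount d n - cosSum d n φ
        = ∑ x ∈ latticeBall d n, (1 - ∏ j, Real.cos (x j * φ j)) := by
          rw [Finset.sum_sub_distrib, ← ballCount_eq_sum, cosSum]
      _ ≤ ∑ x ∈ latticeBall d n, ∑ j, (x j : ℝ) ^ 2 * (2 * Real.sin (φ j / 2) ^ 2) := by
          refine Finset.sum_le_sum fun x _ => (one_sub_prod_le_sum _ _ fun j =>
            Real.abs_cos_le_one _).trans (Finset.sum_le_sum fun j _ => ?_)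
          rw [← one_sub_cos_eq]
          exact one_sub_cos_intCast_mul_le _ _
      _ = ∑ j, 2 * Real.sin (φ j / 2) ^ 2 * ∑ x ∈ latticeBall d n, (x j : ℝ) ^ 2 := by
          rw [Finset.sum_comm]
          simp_rw [Finset.mul_sum, mul_comm]
      _ ≤ _ := by
          refine Finset.sum_le_sum fun j _ => mul_le_mul_of_nonneg_left ?_ (by positivity)
          obtain ⟨d, rfl⟩ : ∃ e, d = e + 1 := ⟨d - 1, by have := j.2; omega⟩
          rw [sum_coord_sq]
          exact coordSqSum_le d n
  rw [one_sub_div hG.ne', div_le_iff₀ hG]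
  refine h1.trans (le_of_eq ?_)
  rw [← Finset.sum_mul, ← Finset.mul_sum]
  ring

lemma sum_symmIcc_neg {M : Type*} [AddCommMonoid M] (L : ℕ) (F : ℤ → M) :
    ∑ k ∈ symmIcc L, F (-k) = ∑ k ∈ symmIcc L, F k :=
  Finset.sum_nbij' (fun k => -k) (fun k => -k) (by simp [mem_symmIcc]) (by simp [mem_symmIcc])
    (by simp) (by simp) (by simp)

/-- The complex exponential sum over the ball is real. -/
lemma sum_prod_exp_eq_cosSum (d n : ℕ) (φ : Fin d → ℝ) :
    ∑ x ∈ latticeBall d n, ∏ j, Complex.exp (x j * φ j * Complex.I) = (cosSum d n φ : ℂ) := by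
  induction d generalizing n with
  | zero => simp [cosSum]
  | succ d ih =>
    have hl : ∑ x ∈ latticeBall (d + 1) n, ∏ j, Complex.exp (x j * φ j * Complex.I) =
        ∑ k ∈ symmIcc n.sqrt, Complex.exp ((k : ℤ) * φ 0 * Complex.I) *
          (cosSum d (n - k.natAbs ^ 2) (Fin.tail φ) : ℂ) := by
      rw [sum_latticeBall_succ]
      refine Finset.sum_congr rfl fun k _ => ?_
      rw [← ih, Finset.mul_sum]
      refine Finset.sum_congr rfl fun y _ => ?_
      rw [Fin.prod_univ_succ]
      simp [Fin.tail]
    have hr : cosSum (d + 1) n φ = ∑ k ∈ symmIcc n.sqrt, Real.cos ((k : ℤ) * φ 0) *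
        cosSum d (n - k.natAbs ^ 2) (Fin.tail φ) := by
      rw [cosSum, sum_latticeBall_succ]
      refine Finset.sum_congr rfl fun k _ => ?_
      rw [cosSum, Finset.mul_sum]
      refine Finset.sum_congr rfl fun y _ => ?_
      rw [Fin.prod_univ_succ]
      simp [Fin.tail]
    have h2 : (2 : ℂ) * ∑ k ∈ symmIcc n.sqrt, Complex.exp ((k : ℤ) * φ 0 * Complex.I) *
          (cosSum d (n - k.natAbs ^ 2) (Fin.tail φ) : ℂ) = 2 * (cosSum (d + 1) n φ : ℂ) := by
      rw [two_mul]
      conv_lhs => arg 1; rw [← sum_symmIcc_neg]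
      rw [← Finset.sum_add_distrib, hr]
      push_cast
      rw [Finset.mul_sum]
      refine Finset.sum_congr rfl fun k _ => ?_
      rw [Int.natAbs_neg, ← mul_assoc, Complex.two_cos]
      ring_nf
    rw [hl]
    exact mul_left_cancel₀ two_ne_zero h2

section Maximal

variable {V : Type*} [AddCommGroup V]

/-- The linearized maximal operators of the kernels `α i`, `i ≤ I`, are bounded on `ℓ²` with
squared norm at most `v`. -/
def MaximalBound (α : ℕ → V → ℝ) (I : ℕ) (v : ℝ) : Prop :=
  ∀ (X Y : Finset V) (f : V → ℝ) (ι : V → ℕ), (∀ y, 0 ≤ f y) → (∀ x ∈ X, ι x ≤ I) →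
    ∑ x ∈ X, (∑ y ∈ Y, α (ι x) (x - y) * f y) ^ 2 ≤ v * ∑ y ∈ Y, f y ^ 2

variable {α : ℕ → V → ℝ}

lemma sum_sq_conv_le (h0 : ∀ i x, 0 ≤ α i x) (h1 : ∀ i (Y : Finset V), ∑ y ∈ Y, α i y ≤ 1)
    (i : ℕ) (X Y : Finset V) (f : V → ℝ) :
    ∑ x ∈ X, (∑ y ∈ Y, α i (x - y) * f y) ^ 2 ≤ ∑ y ∈ Y, f y ^ 2 := by
  classical
  have hl : ∀ x, ∑ y ∈ Y, α i (x - y) ≤ 1 := fun x => by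
    rw [← Finset.sum_image (g := fun y => x - y) (f := α i) fun a _ b _ h => sub_right_injective h]
    exact h1 _ _
  have hr : ∀ y, ∑ x ∈ X, α i (x - y) ≤ 1 := fun y => by
    rw [← Finset.sum_image (g := fun x => x - y) (f := α i) fun a _ b _ h => sub_left_injective h]
    exact h1 _ _
  calc ∑ x ∈ X, (∑ y ∈ Y, α i (x - y) * f y) ^ 2
      ≤ ∑ x ∈ X, ∑ y ∈ Y, α i (x - y) * f y ^ 2 := by
        refine Finset.sum_le_sum fun x _ => ?_
        have hnn : 0 ≤ ∑ y ∈ Y, α i (x - y) * f y ^ 2 :=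
          Finset.sum_nonneg fun y _ => mul_nonneg (h0 _ _) (sq_nonneg _)
        refine (Finset.sum_sq_le_sum_mul_sum_of_sq_le_mul Y (f := fun y => α i (x - y))
          (g := fun y => α i (x - y) * f y ^ 2) (fun y _ => h0 _ _)
          (fun y _ => mul_nonneg (h0 _ _) (sq_nonneg _)) fun y _ => le_of_eq (by ring)).trans ?_
        exact mul_le_of_le_one_left hnn (hl x)
    _ = ∑ y ∈ Y, (∑ x ∈ X, α i (x - y)) * f y ^ 2 := by
        rw [Finset.sum_comm]
        simp_rw [Finset.sum_mul]
    _ ≤ _ := Finset.sum_le_sum fun y _ => mul_le_of_le_one_left (sq_nonneg _) (hr y)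

lemma MaximalBound.succ (h0 : ∀ i x, 0 ≤ α i x)
    (h1 : ∀ i (Y : Finset V), ∑ y ∈ Y, α i y ≤ 1) {I : ℕ} {v : ℝ} (h : MaximalBound α I v) :
    MaximalBound α (I + 1) (v + 1) := by
  intro X Y f ι hf hι
  rw [← Finset.sum_filter_add_sum_filter_not X fun x => ι x ≤ I, add_mul, one_mul]
  refine add_le_add (h _ Y f ι hf fun x hx => (Finset.mem_filter.1 hx).2) ?_
  refine le_trans (le_of_eq (Finset.sum_congr rfl fun x hx => ?_))
    (sum_sq_conv_le h0 h1 (I + 1) (X.filter fun x => ¬ι x ≤ I) Y f)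
  have := Finset.mem_filter.1 hx
  have := hι x this.1
  rw [show ι x = I + 1 by omega]

/-- Improvement of the bound by the `TT*` argument. -/
lemma MaximalBound.refine (h0 : ∀ i x, 0 ≤ α i x) (hs : ∀ i x, α i (-x) = α i x)
    (h2 : ∀ i j x z (Y : Finset V),
      ∑ y ∈ Y, α i (x - y) * α j (z - y) ≤ 2 * α (max i j + 1) (x - z))
    {J : ℕ} (h : MaximalBound α (J + 1) 20) : MaximalBound α J 18 := by
  intro X Y f ι hf hι
  set g : V → ℝ := fun x => ∑ y ∈ Y, α (ι x) (x - y) * f y with hg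
  have hg0 : ∀ x, 0 ≤ g x := fun x => Finset.sum_nonneg fun y _ => mul_nonneg (h0 _ _) (hf y)
  set Q := ∑ x ∈ X, g x ^ 2 with hQ
  have hQ0 : 0 ≤ Q := Finset.sum_nonneg fun x _ => sq_nonneg _
  set F := ∑ y ∈ Y, f y ^ 2 with hF
  have hF0 : 0 ≤ F := Finset.sum_nonneg fun x _ => sq_nonneg _
  set T := ∑ x ∈ X, g x * ∑ z ∈ X, α (ι x + 1) (x - z) * g z with hT
  have hT0 : 0 ≤ T := Finset.sum_nonneg fun x _ => mul_nonneg (hg0 x)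
    (Finset.sum_nonneg fun z _ => mul_nonneg (h0 _ _) (hg0 z))
  have hTQ : T ≤ 9 / 2 * Q := by
    have e1 : T ^ 2 ≤ Q * (20 * Q) := (Finset.sum_mul_sq_le_sq_mul_sq X g _).trans
      (mul_le_mul_of_nonneg_left (h X X g (fun x => ι x + 1) hg0 fun x hx =>
        Nat.succ_le_succ (hι x hx)) hQ0)
    refine le_of_sq_le_sq (?_ : T ^ 2 ≤ (9 / 2 * Q) ^ 2) (by positivity)
    nlinarith [sq_nonneg Q]
  have hdual : Q = ∑ y ∈ Y, f y * ∑ x ∈ X, g x * α (ι x) (x - y) := by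
    have : Q = ∑ x ∈ X, ∑ y ∈ Y, g x * (α (ι x) (x - y) * f y) :=
      Finset.sum_congr rfl fun x _ => by rw [← Finset.mul_sum, sq]
    rw [this, Finset.sum_comm]
    refine Finset.sum_congr rfl fun y _ => ?_
    rw [Finset.mul_sum]
    exact Finset.sum_congr rfl fun x _ => by ring
  have hTT : ∑ y ∈ Y, (∑ x ∈ X, g x * α (ι x) (x - y)) ^ 2 ≤ 4 * T := by
    calc _ = ∑ x ∈ X, ∑ z ∈ X, g x * g z * ∑ y ∈ Y, α (ι x) (x - y) * α (ι z) (z - y) := by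
          simp_rw [sq, Finset.sum_mul_sum, Finset.mul_sum]
          rw [Finset.sum_comm]
          refine Finset.sum_congr rfl fun x _ => ?_
          rw [Finset.sum_comm]
          exact Finset.sum_congr rfl fun z _ => Finset.sum_congr rfl fun y _ => by ring
      _ ≤ ∑ x ∈ X, ∑ z ∈ X, (2 * (g x * (α (ι x + 1) (x - z) * g z)) +
            2 * (g z * (α (ι z + 1) (z - x) * g x))) := by
          refine Finset.sum_le_sum fun x _ => Finset.sum_le_sum fun z _ => ?_
          have e1 := h2 (ι x) (ι z) x z Y
          have e2 : α (max (ι x) (ι z) + 1) (x - z) ≤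
              α (ι x + 1) (x - z) + α (ι z + 1) (z - x) := by
            rw [← neg_sub x z, hs]
            rcases max_choice (ι x) (ι z) with h | h <;> rw [h]
            · linarith [h0 (ι z + 1) (x - z)]
            · linarith [h0 (ι x + 1) (x - z)]
          have e3 := mul_le_mul_of_nonneg_left (e1.trans (mul_le_mul_of_nonneg_left e2
            zero_le_two)) (mul_nonneg (hg0 x) (hg0 z))
          refine e3.trans (le_of_eq (by ring))
      _ = 4 * T := by
          have e : ∑ x ∈ X, ∑ z ∈ X, g z * (α (ι z + 1) (z - x) * g x) = T := by
            rw [Finset.sum_comm]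
            simp_rw [hT, Finset.mul_sum]
          simp_rw [Finset.sum_add_distrib, ← Finset.mul_sum]
          rw [e, ← hT]
          ring
  have hfin : Q ^ 2 ≤ F * (18 * Q) := by
    conv_lhs => rw [hdual]
    refine (Finset.sum_mul_sq_le_sq_mul_sq Y f _).trans (mul_le_mul_of_nonneg_left ?_ hF0)
    linarith
  change Q ≤ 18 * F
  rcases hQ0.eq_or_lt with hQz | hQp
  · rw [← hQz]; positivity
  · nlinarith

/-- A maximal inequality for symmetric kernels satisfying a quasi-semigroup inequality. -/
theorem maximalBound (h0 : ∀ i x, 0 ≤ α i x) (hs : ∀ i x, α i (-x) = α i x)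
    (h1 : ∀ i (Y : Finset V), ∑ y ∈ Y, α i y ≤ 1)
    (h2 : ∀ i j x z (Y : Finset V),
      ∑ y ∈ Y, α i (x - y) * α j (z - y) ≤ 2 * α (max i j + 1) (x - z)) (I : ℕ) :
    MaximalBound α I 18 := by
  induction I with
  | zero =>
    intro X Y f ι hf hι
    have hF0 : 0 ≤ ∑ y ∈ Y, f y ^ 2 := Finset.sum_nonneg fun x _ => sq_nonneg _
    have := sum_sq_conv_le h0 h1 0 X Y f
    rw [Finset.sum_congr rfl fun x hx => by rw [Nat.le_zero.1 (hι x hx)]]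
    linarith
  | succ I ih =>
    refine MaximalBound.refine h0 hs h2 ?_
    have := (ih.succ h0 h1).succ h0 h1
    norm_num at this
    exact this

end Maximal

section Cesaro

variable {V : Type*} [AddCommGroup V]

lemma coeff_mul_sum_single (P : AddMonoidAlgebra ℝ V) (Y : Finset V) (f : V → ℝ) (x : V) :
    (P * ∑ y ∈ Y, AddMonoidAlgebra.single y (f y)).coeff x = ∑ y ∈ Y, P.coeff (x - y) * f y := by
  rw [Finset.mul_sum, AddMonoidAlgebra.coeff_sum, Finsupp.finsetSum_apply]
  refine Finset.sum_congr rfl fun y _ => ?_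
  exact AddMonoidAlgebra.coeff_mul_single_eq_coeff_mul (x - y) fun a _ => eq_sub_iff_add_eq.symm

lemma coeff_mul_eq_sum (P Q : AddMonoidAlgebra ℝ V) (x : V) :
    (P * Q).coeff x = ∑ y ∈ Q.coeff.support, P.coeff (x - y) * Q.coeff y := by
  conv_lhs => rw [← AddMonoidAlgebra.sum_coeff_single Q]
  exact coeff_mul_sum_single P _ _ x

lemma coeff_mul_nonneg {P Q : AddMonoidAlgebra ℝ V} (hP : ∀ x, 0 ≤ P.coeff x)
    (hQ : ∀ x, 0 ≤ Q.coeff x) (x : V) : 0 ≤ (P * Q).coeff x := by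
  rw [coeff_mul_eq_sum]
  exact Finset.sum_nonneg fun y _ => mul_nonneg (hP _) (hQ _)

lemma coeff_mul_neg {P Q : AddMonoidAlgebra ℝ V} (hP : ∀ x, P.coeff (-x) = P.coeff x)
    (hQ : ∀ x, Q.coeff (-x) = Q.coeff x) (x : V) : (P * Q).coeff (-x) = (P * Q).coeff x := by
  rw [coeff_mul_eq_sum, coeff_mul_eq_sum]
  refine Finset.sum_nbij' (fun y => -y) (fun y => -y) ?_ ?_ (by simp) (by simp) ?_
  · intro y hy; simpa [hQ] using hy
  · intro y hy; simpa [hQ] using hy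
  · intro y _
    rw [hQ, ← hP, neg_sub, sub_neg_eq_add, sub_neg_eq_add, add_comm]

lemma sum_mul_le_coeff_mul {P Q : AddMonoidAlgebra ℝ V} (hP : ∀ x, 0 ≤ P.coeff x)
    (hQ : ∀ x, 0 ≤ Q.coeff x) (Y : Finset V) (x : V) :
    ∑ y ∈ Y, P.coeff (x - y) * Q.coeff y ≤ (P * Q).coeff x := by
  classical
  rw [coeff_mul_eq_sum]
  calc _ ≤ ∑ y ∈ Y ∪ Q.coeff.support, P.coeff (x - y) * Q.coeff y :=
        Finset.sum_le_sum_of_subset_of_nonneg Finset.subset_union_left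
          fun y _ _ => mul_nonneg (hP _) (hQ _)
    _ = _ := by
        refine (Finset.sum_subset Finset.subset_union_right fun y _ hy => ?_).symm
        rw [Finsupp.notMem_support_iff.1 hy, mul_zero]

/-- The Cesàro means of the powers of a kernel at dyadic times. -/
noncomputable def cesaro (K : AddMonoidAlgebra ℝ V) (i : ℕ) : AddMonoidAlgebra ℝ V :=
  ((2 : ℝ) ^ i)⁻¹ • ∑ k ∈ Finset.range (2 ^ i), K ^ k

lemma coeff_cesaro (K : AddMonoidAlgebra ℝ V) (i : ℕ) (x : V) :
    (cesaro K i).coeff x = ((2 : ℝ) ^ i)⁻¹ * ∑ k ∈ Finset.range (2 ^ i), (K ^ k).coeff x := by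
  rw [cesaro, AddMonoidAlgebra.coeff_smul_apply, AddMonoidAlgebra.coeff_sum,
    Finsupp.finsetSum_apply, smul_eq_mul]

variable {K : AddMonoidAlgebra ℝ V}

lemma coeff_pow_nonneg (hK : ∀ x, 0 ≤ K.coeff x) (k : ℕ) (x : V) : 0 ≤ (K ^ k).coeff x := by
  induction k generalizing x with
  | zero =>
    classical
    rw [pow_zero, AddMonoidAlgebra.one_def, AddMonoidAlgebra.coeff_single,
      Finsupp.single_apply]
    split_ifs <;> norm_num
  | succ k ih => rw [pow_succ]; exact coeff_mul_nonneg ih hK x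

lemma coeff_pow_neg (hK : ∀ x, K.coeff (-x) = K.coeff x) (k : ℕ) (x : V) :
    (K ^ k).coeff (-x) = (K ^ k).coeff x := by
  induction k generalizing x with
  | zero =>
    classical
    rw [pow_zero, AddMonoidAlgebra.one_def, AddMonoidAlgebra.coeff_single,
      Finsupp.single_apply, Finsupp.single_apply]
    simp only [eq_comm (a := (0 : V)), neg_eq_zero]
  | succ k ih => rw [pow_succ]; exact coeff_mul_neg ih hK x

lemma coeff_cesaro_nonneg (hK : ∀ x, 0 ≤ K.coeff x) (i : ℕ) (x : V) :
    0 ≤ (cesaro K i).coeff x := by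
  rw [coeff_cesaro]
  exact mul_nonneg (by positivity) (Finset.sum_nonneg fun k _ => coeff_pow_nonneg hK k x)

lemma coeff_cesaro_neg (hK : ∀ x, K.coeff (-x) = K.coeff x) (i : ℕ) (x : V) :
    (cesaro K i).coeff (-x) = (cesaro K i).coeff x := by
  simp_rw [coeff_cesaro, coeff_pow_neg hK]

lemma sum_coeff_cesaro_le (hK : ∀ x, 0 ≤ K.coeff x)
    (hK1 : AddMonoidAlgebra.lift ℝ ℝ V 1 K = 1) (i : ℕ) (Y : Finset V) :
    ∑ y ∈ Y, (cesaro K i).coeff y ≤ 1 := by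
  classical
  have h1 : AddMonoidAlgebra.lift ℝ ℝ V 1 (cesaro K i) = 1 := by
    rw [cesaro, map_smul, map_sum]
    simp [map_pow, hK1]
  rw [AddMonoidAlgebra.lift_apply, Finsupp.sum] at h1
  simp only [MonoidHom.one_apply, smul_eq_mul, mul_one] at h1
  rw [← h1]
  calc _ ≤ ∑ y ∈ Y ∪ (cesaro K i).coeff.support, (cesaro K i).coeff y :=
        Finset.sum_le_sum_of_subset_of_nonneg Finset.subset_union_left
          fun y _ _ => coeff_cesaro_nonneg hK i y
    _ = _ := (Finset.sum_subset Finset.subset_union_right fun y _ hy =>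
        Finsupp.notMem_support_iff.1 hy).symm

lemma coeff_cesaro_mul_le (hK : ∀ x, 0 ≤ K.coeff x) {i j : ℕ} (hij : i ≤ j) (x : V) :
    (cesaro K i * cesaro K j).coeff x ≤ 2 * (cesaro K (j + 1)).coeff x := by
  have hsum : ∀ k ∈ Finset.range (2 ^ i), ∑ l ∈ Finset.range (2 ^ j), (K ^ (k + l)).coeff x ≤
      ∑ l ∈ Finset.range (2 ^ (j + 1)), (K ^ l).coeff x := by
    intro k hk
    have hk : k < 2 ^ i := Finset.mem_range.1 hk
    have hij : 2 ^ i ≤ 2 ^ j := Nat.pow_le_pow_right (by norm_num) hij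
    rw [← Finset.sum_image (g := fun l => k + l) (f := fun l => (K ^ l).coeff x)
      fun a _ b _ h => Nat.add_left_cancel h]
    refine Finset.sum_le_sum_of_subset_of_nonneg ?_ fun l _ _ => coeff_pow_nonneg hK l x
    intro l hl
    obtain ⟨l', hl', rfl⟩ := Finset.mem_image.1 hl
    have := Finset.mem_range.1 hl'
    rw [Finset.mem_range, pow_succ]
    omega
  have hexp : (cesaro K i * cesaro K j).coeff x = ((2 : ℝ) ^ i)⁻¹ * (((2 : ℝ) ^ j)⁻¹ *
      ∑ k ∈ Finset.range (2 ^ i), ∑ l ∈ Finset.range (2 ^ j), (K ^ (k + l)).coeff x) := by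
    rw [cesaro, cesaro, smul_mul_smul_comm, Finset.sum_mul_sum,
      AddMonoidAlgebra.coeff_smul_apply, AddMonoidAlgebra.coeff_sum, Finsupp.finsetSum_apply,
      smul_eq_mul, mul_assoc]
    simp_rw [AddMonoidAlgebra.coeff_sum, Finsupp.finsetSum_apply, pow_add]
  rw [hexp, coeff_cesaro]
  calc _ ≤ ((2 : ℝ) ^ i)⁻¹ * (((2 : ℝ) ^ j)⁻¹ * ∑ k ∈ Finset.range (2 ^ i),
        ∑ l ∈ Finset.range (2 ^ (j + 1)), (K ^ l).coeff x) := by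
        gcongr with k hk
        exact hsum k hk
    _ = _ := by
        rw [Finset.sum_const, Finset.card_range, nsmul_eq_mul, pow_succ]
        push_cast
        field_simp
        ring

/-- The maximal theorem for the Cesàro means of a symmetric Markov kernel. -/
theorem maximalBound_cesaro (hK : ∀ x, 0 ≤ K.coeff x) (hKs : ∀ x, K.coeff (-x) = K.coeff x)
    (hK1 : AddMonoidAlgebra.lift ℝ ℝ V 1 K = 1) (I : ℕ) :
    MaximalBound (fun i x => (cesaro K i).coeff x) I 18 := by
  refine maximalBound (fun i => coeff_cesaro_nonneg hK i) (fun i => coeff_cesaro_neg hKs i)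
    (fun i => sum_coeff_cesaro_le hK hK1 i) (fun i j x z Y => ?_) I
  have h1 : ∑ y ∈ Y, (cesaro K i).coeff (x - y) * (cesaro K j).coeff (z - y) ≤
      (cesaro K i * cesaro K j).coeff (x - z) := by
    refine le_trans (le_of_eq ?_) (sum_mul_le_coeff_mul (coeff_cesaro_nonneg hK i)
      (coeff_cesaro_nonneg hK j) (Y.map ⟨fun y => y - z, sub_left_injective⟩) (x - z))
    rw [Finset.sum_map]
    refine Finset.sum_congr rfl fun y _ => ?_
    simp only [Function.Embedding.coeFn_mk, sub_sub_sub_cancel_right]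
    rw [← coeff_cesaro_neg hKs j (z - y), neg_sub]
  refine h1.trans ?_
  rcases le_total i j with h | h
  · rw [max_eq_right h]
    exact coeff_cesaro_mul_le hK h _
  · rw [max_eq_left h, mul_comm]
    exact coeff_cesaro_mul_le hK h _

end Cesaro

section Plancherel

/-- The character `x ↦ exp(i⟨x, φ⟩)` of `ℤ^d`. -/
noncomputable def latticeChar {d : ℕ} (φ : Fin d → ℝ) : Multiplicative (Fin d → ℤ) →* ℂ where
  toFun x := ∏ j, Complex.exp (x.toAdd j * φ j * Complex.I)
  map_one' := by simp
  map_mul' x y := by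
    rw [← Finset.prod_mul_distrib]
    refine Finset.prod_congr rfl fun j _ => ?_
    rw [← Complex.exp_add, toAdd_mul, Pi.add_apply]
    push_cast
    ring_nf

/-- The Fourier transform of a finitely supported function on `ℤ^d`, at the frequency `φ`. -/
noncomputable def symbolAt {d : ℕ} (φ : Fin d → ℝ) : AddMonoidAlgebra ℝ (Fin d → ℤ) →ₐ[ℝ] ℂ :=
  AddMonoidAlgebra.lift ℝ ℂ (Fin d → ℤ) (latticeChar φ)

lemma symbolAt_single {d : ℕ} (φ : Fin d → ℝ) (x : Fin d → ℤ) (a : ℝ) :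
    symbolAt φ (AddMonoidAlgebra.single x a) = a * ∏ j, Complex.exp (x j * φ j * Complex.I) := by
  rw [symbolAt, AddMonoidAlgebra.lift_single, Complex.real_smul]
  rfl

noncomputable local instance : MeasureSpace UnitAddCircle := ⟨AddCircle.haarAddCircle⟩

local instance : Measure.IsAddHaarMeasure (volume : Measure UnitAddCircle) :=
  inferInstanceAs (Measure.IsAddHaarMeasure AddCircle.haarAddCircle)

local instance : IsProbabilityMeasure (volume : Measure UnitAddCircle) :=
  inferInstanceAs (IsProbabilityMeasure AddCircle.haarAddCircle)

/-- The trigonometric polynomial with the given coefficients. -/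
noncomputable def trigPoly {d : ℕ} (P : AddMonoidAlgebra ℝ (Fin d → ℤ)) :
    C(UnitAddTorus (Fin d), ℂ) :=
  ∑ x ∈ P.coeff.support, (P.coeff x : ℂ) • UnitAddTorus.mFourier x

lemma integral_norm_trigPoly_sq {d : ℕ} (P : AddMonoidAlgebra ℝ (Fin d → ℤ)) :
    ∫ ξ, ‖trigPoly P ξ‖ ^ 2 = P.coeff.sum fun _ a => a ^ 2 := by
  have h1 := ContinuousMap.inner_toLp (𝕜 := ℂ)
    (volume : Measure (UnitAddTorus (Fin d))) (trigPoly P) (trigPoly P)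
  have h2 := (UnitAddTorus.orthonormal_mFourier (d := Fin d)).inner_sum
    (fun x => (P.coeff x : ℂ)) (fun x => (P.coeff x : ℂ)) P.coeff.support
  have h3 : ContinuousMap.toLp 2 (volume : Measure (UnitAddTorus (Fin d))) ℂ (trigPoly P) =
      ∑ x ∈ P.coeff.support, (P.coeff x : ℂ) • UnitAddTorus.mFourierLp 2 x := by
    rw [trigPoly, map_sum]
    simp_rw [map_smul]
  rw [h3, h2] at h1
  have h4 : ∀ ξ, trigPoly P ξ * (starRingEnd ℂ) (trigPoly P ξ) =
      ((‖trigPoly P ξ‖ ^ 2 : ℝ) : ℂ) := fun ξ => by rw [Complex.mul_conj']; push_cast; rfl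
  simp_rw [h4] at h1
  rw [integral_complex_ofReal] at h1
  rw [Finsupp.sum, ← Complex.ofReal_inj, ← h1]
  push_cast
  exact Finset.sum_congr rfl fun x _ => by rw [Complex.conj_ofReal, sq]

lemma exists_trigPoly_eq_symbolAt {d : ℕ} (ξ : UnitAddTorus (Fin d)) :
    ∃ φ : Fin d → ℝ, ∀ P, trigPoly P ξ = symbolAt φ P := by
  choose t ht using fun j => QuotientAddGroup.mk_surjective (ξ j)
  refine ⟨fun j => 2 * Real.pi * t j, fun P => ?_⟩
  rw [symbolAt, AddMonoidAlgebra.lift_apply, Finsupp.sum, trigPoly, ContinuousMap.sum_apply]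
  refine Finset.sum_congr rfl fun x _ => ?_
  rw [ContinuousMap.smul_apply, smul_eq_mul, Complex.real_smul]
  congr 1
  change ∏ j : Fin d, fourier (x j) (ξ j) =
    ∏ j : Fin d, Complex.exp (x j * ((2 * Real.pi * t j : ℝ) : ℂ) * Complex.I)
  refine Finset.prod_congr rfl fun j _ => ?_
  rw [← ht j]
  refine (fourier_coe_apply (T := (1 : ℝ)) (n := x j) (x := t j)).trans ?_
  congr 1
  push_cast
  ring

/-- A pointwise square function bound for symbols gives the same bound in `ℓ²`. -/
lemma sum_sq_le_of_symbolAt_le {d : ℕ} {ι : Type*} (F : Finset ι)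
    (P : ι → AddMonoidAlgebra ℝ (Fin d → ℤ)) (Q : AddMonoidAlgebra ℝ (Fin d → ℤ)) (C : ℝ)
    (h : ∀ φ : Fin d → ℝ, ∑ i ∈ F, ‖symbolAt φ (P i)‖ ^ 2 ≤ C * ‖symbolAt φ Q‖ ^ 2) :
    ∑ i ∈ F, ((P i).coeff.sum fun _ a => a ^ 2) ≤ C * Q.coeff.sum fun _ a => a ^ 2 := by
  have hint : ∀ P : AddMonoidAlgebra ℝ (Fin d → ℤ),
      Integrable (fun ξ => ‖trigPoly P ξ‖ ^ 2) := fun P =>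
    ((trigPoly P).continuous.norm.pow 2).integrable_of_hasCompactSupport
      (HasCompactSupport.of_compactSpace _)
  simp_rw [← integral_norm_trigPoly_sq]
  rw [← integral_finsetSum _ fun i _ => hint (P i), ← integral_const_mul]
  refine integral_mono (integrable_finsetSum _ fun i _ => hint (P i)) ((hint Q).const_mul C)
    fun ξ => ?_
  obtain ⟨φ, hφ⟩ := exists_trigPoly_eq_symbolAt ξ
  simp only [hφ]
  exact h φ

end Plancherel

section LazyWalk

/-- The step distribution of the lazy nearest neighbour random walk on `ℤ^d`. -/
noncomputable def lazyWalk (d : ℕ) : AddMonoidAlgebra ℝ (Fin d → ℤ) :=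
  AddMonoidAlgebra.single 0 (1 / 2) +
    ∑ j, (AddMonoidAlgebra.single (Pi.single j 1) (1 / (4 * d : ℝ)) +
      AddMonoidAlgebra.single (-Pi.single j 1) (1 / (4 * d : ℝ)))

lemma coeff_lazyWalk_nonneg (d : ℕ) (x : Fin d → ℤ) : 0 ≤ (lazyWalk d).coeff x := by
  classical
  rw [lazyWalk, AddMonoidAlgebra.coeff_add, Finsupp.add_apply, AddMonoidAlgebra.coeff_sum,
    Finsupp.finsetSum_apply]
  simp only [AddMonoidAlgebra.coeff_add, Finsupp.add_apply, AddMonoidAlgebra.coeff_single,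
    Finsupp.single_apply]
  refine add_nonneg (by split_ifs <;> norm_num) (Finset.sum_nonneg fun j _ => add_nonneg ?_ ?_) <;>
  · split_ifs <;> positivity

lemma coeff_lazyWalk_neg (d : ℕ) (x : Fin d → ℤ) :
    (lazyWalk d).coeff (-x) = (lazyWalk d).coeff x := by
  classical
  rw [lazyWalk, AddMonoidAlgebra.coeff_add, Finsupp.add_apply, Finsupp.add_apply,
    AddMonoidAlgebra.coeff_sum, Finsupp.finsetSum_apply, Finsupp.finsetSum_apply]
  simp only [AddMonoidAlgebra.coeff_add, Finsupp.add_apply, AddMonoidAlgebra.coeff_single,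
    Finsupp.single_apply]
  refine congrArg₂ _ (if_congr (by rw [eq_comm, neg_eq_zero, eq_comm]) rfl rfl)
    (Finset.sum_congr rfl fun j _ => ?_)
  rw [add_comm]
  exact congrArg₂ _ (if_congr neg_inj rfl rfl) (if_congr neg_eq_iff_eq_neg.symm rfl rfl)

lemma lift_one_lazyWalk {d : ℕ} (hd : 1 ≤ d) :
    AddMonoidAlgebra.lift ℝ ℝ (Fin d → ℤ) 1 (lazyWalk d) = 1 := by
  have : (d : ℝ) ≠ 0 := by positivity
  rw [lazyWalk, map_add, map_sum]
  simp only [map_add, AddMonoidAlgebra.lift_single, MonoidHom.one_apply, smul_eq_mul,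
    Finset.sum_const, Finset.card_univ, Fintype.card_fin, nsmul_eq_mul]
  field_simp
  norm_num

lemma symbolAt_lazyWalk {d : ℕ} (hd : 1 ≤ d) (φ : Fin d → ℝ) :
    symbolAt φ (lazyWalk d) = ((1 - (∑ j, Real.sin (φ j / 2) ^ 2) / d : ℝ) : ℂ) := by
  have hd0 : (d : ℝ) ≠ 0 := by positivity
  have h1 : ∀ j : Fin d, ∏ i, Complex.exp (((Pi.single j 1 : Fin d → ℤ) i : ℂ) * φ i * Complex.I) =
      Complex.exp (φ j * Complex.I) := fun j => by
    rw [Finset.prod_eq_single j]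
    · simp
    · intro i _ hi; simp [Pi.single_eq_of_ne hi]
    · simp
  have h2 : ∀ j : Fin d, ∏ i, Complex.exp (((-Pi.single j 1 : Fin d → ℤ) i : ℂ) * φ i * Complex.I) =
      Complex.exp (-(φ j) * Complex.I) := fun j => by
    rw [Finset.prod_eq_single j]
    · simp
    · intro i _ hi; simp [Pi.single_eq_of_ne hi]
    · simp
  have h3 : ∀ j : Fin d, ((1 / (4 * d : ℝ) : ℝ) : ℂ) * Complex.exp (φ j * Complex.I) +
      ((1 / (4 * d : ℝ) : ℝ) : ℂ) * Complex.exp (-(φ j) * Complex.I) =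
      ((1 / (2 * d) - Real.sin (φ j / 2) ^ 2 / d : ℝ) : ℂ) := fun j => by
    have hs : Real.sin (φ j / 2) ^ 2 = (1 - Real.cos (φ j)) / 2 := by
      rw [one_sub_cos_eq]; ring
    rw [← mul_add, ← Complex.two_cos, hs, ← Complex.ofReal_cos, ← Complex.ofReal_ofNat,
      ← Complex.ofReal_mul, ← Complex.ofReal_mul]
    congr 1
    field_simp
    ring
  rw [lazyWalk, map_add, map_sum, symbolAt_single]
  simp_rw [map_add, symbolAt_single, h1, h2, h3]
  rw [← Complex.ofReal_sum, Finset.sum_sub_distrib, Finset.sum_const, ← Finset.sum_div]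
  simp only [Pi.zero_apply, Int.cast_zero, zero_mul, Complex.exp_zero, Finset.prod_const_one,
    mul_one, Finset.card_univ, Fintype.card_fin, nsmul_eq_mul]
  rw [← Complex.ofReal_add]
  congr 1
  field_simp
  ring

/-- The Cesàro means of the powers of a real number. -/
noncomputable def cesaroReal (l : ℝ) (i : ℕ) : ℝ :=
  ((2 : ℝ) ^ i)⁻¹ * ∑ k ∈ Finset.range (2 ^ i), l ^ k

lemma symbolAt_cesaro {d : ℕ} {φ : Fin d → ℝ} {K : AddMonoidAlgebra ℝ (Fin d → ℤ)} {l : ℝ}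
    (h : symbolAt φ K = (l : ℂ)) (i : ℕ) : symbolAt φ (cesaro K i) = (cesaroReal l i : ℂ) := by
  rw [cesaro, map_smul, map_sum, Complex.real_smul, cesaroReal]
  simp [h]

lemma cesaroReal_nonneg {l : ℝ} (hl : 0 ≤ l) (i : ℕ) : 0 ≤ cesaroReal l i :=
  mul_nonneg (by positivity) (Finset.sum_nonneg fun k _ => pow_nonneg hl k)

lemma cesaroReal_le_one {l : ℝ} (hl : 0 ≤ l) (hl1 : l ≤ 1) (i : ℕ) : cesaroReal l i ≤ 1 := by
  rw [cesaroReal, inv_mul_le_iff₀ (by positivity), mul_one]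
  refine (Finset.sum_le_card_nsmul _ _ 1 fun k _ => pow_le_one₀ hl hl1).trans ?_
  simp

lemma cesaroReal_mul_le {l : ℝ} (hl : 0 ≤ l) (i : ℕ) :
    cesaroReal l i * (2 ^ i * (1 - l)) ≤ 1 := by
  have h := geom_sum_mul_neg l (2 ^ i)
  rw [cesaroReal]
  have : ((2 : ℝ) ^ i)⁻¹ * (∑ k ∈ Finset.range (2 ^ i), l ^ k) * (2 ^ i * (1 - l)) =
      1 - l ^ 2 ^ i := by
    rw [← h]; field_simp
  rw [this]
  linarith [pow_nonneg hl (2 ^ i)]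

lemma one_sub_cesaroReal_le {l : ℝ} (hl : 0 ≤ l) (hl1 : l ≤ 1) (i : ℕ) :
    1 - cesaroReal l i ≤ 2 ^ i * (1 - l) := by
  have h : ∀ k ∈ Finset.range (2 ^ i), 1 - 2 ^ i * (1 - l) ≤ l ^ k := fun k hk => by
    have h1 := one_add_mul_le_pow (a := l - 1) (by linarith) k
    have h2 : (k : ℝ) ≤ 2 ^ i := by exact_mod_cast (Finset.mem_range.1 hk).le
    rw [add_sub_cancel] at h1
    nlinarith
  have h2 := Finset.card_nsmul_le_sum _ _ _ h
  rw [Finset.card_range, nsmul_eq_mul, Nat.cast_pow, Nat.cast_ofNat] at h2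
  have h3 := mul_le_mul_of_nonneg_left h2 (by positivity : (0 : ℝ) ≤ ((2 : ℝ) ^ i)⁻¹)
  rw [inv_mul_cancel_left₀ (by positivity)] at h3
  rw [cesaroReal]
  linarith

/-- The uniform distribution on the lattice points of squared norm at most `n`. -/
noncomputable def ballElt (d n : ℕ) : AddMonoidAlgebra ℝ (Fin d → ℤ) :=
  (ballCount d n)⁻¹ • ∑ x ∈ latticeBall d n, AddMonoidAlgebra.single x 1

lemma coeff_ballElt (d n : ℕ) (x : Fin d → ℤ) :
    (ballElt d n).coeff x = if x ∈ latticeBall d n then (ballCount d n)⁻¹ else 0 := by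
  classical
  rw [ballElt, AddMonoidAlgebra.coeff_smul_apply, AddMonoidAlgebra.coeff_sum,
    Finsupp.finsetSum_apply]
  simp only [AddMonoidAlgebra.coeff_single, Finsupp.single_apply, Finset.sum_ite_eq',
    smul_eq_mul, mul_ite, mul_one, mul_zero]

lemma symbolAt_ballElt (d n : ℕ) (φ : Fin d → ℝ) :
    symbolAt φ (ballElt d n) = ((cosSum d n φ / ballCount d n : ℝ) : ℂ) := by
  rw [ballElt, map_smul, map_sum, Complex.real_smul]
  simp_rw [symbolAt_single, Complex.ofReal_one, one_mul]
  rw [sum_prod_exp_eq_cosSum]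
  push_cast
  ring

end LazyWalk

section SquareFunction

/-- Comparison of the multiplier of the ball with that of the lazy random walk. -/
lemma exists_multiplier_sub_cesaroReal_sq_le : ∃ C : ℝ, 0 < C ∧ ∀ (d i : ℕ) (φ : Fin d → ℝ),
    1 ≤ d → ∀ y : ℝ, y = √((2 ^ i : ℕ) / d * ∑ j, Real.sin (φ j / 2) ^ 2) →
    (cosSum d (2 ^ i) φ / ballCount d (2 ^ i) -
      cesaroReal (1 - (∑ j, Real.sin (φ j / 2) ^ 2) / d) i) ^ 2 ≤
      C * (min y y⁻¹ + d / (2 ^ i : ℕ)) := by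
  obtain ⟨C, hC, h⟩ := exists_multiplier_sq_le
  refine ⟨2 * C + 9, by positivity, fun d i φ hd y hy => ?_⟩
  have hd0 : (0 : ℝ) < d := by positivity
  set s := ∑ j, Real.sin (φ j / 2) ^ 2 with hs
  have hs0 : 0 ≤ s := Finset.sum_nonneg fun j _ => sq_nonneg _
  have hsd : s / d ≤ 1 := by
    rw [div_le_one hd0]
    refine (Finset.sum_le_card_nsmul _ _ 1 fun j _ => Real.sin_sq_le_one _).trans ?_
    simp
  have hl : 0 ≤ 1 - s / d := by linarith
  have hl1 : 1 - s / d ≤ 1 := by linarith [div_nonneg hs0 hd0.le]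
  have hm := abs_multiplier_sub_one_le d (2 ^ i) φ
  have hmC := h d (2 ^ i) φ hd Nat.one_le_two_pow
  rw [← hs] at hm hmC
  rw [← hy] at hmC
  have ha0 := cesaroReal_nonneg hl i
  have ha1 := cesaroReal_mul_le hl i
  have ha2 := one_sub_cesaroReal_le hl hl1 i
  have ha3 := cesaroReal_le_one hl hl1 i
  set m := cosSum d (2 ^ i) φ / ballCount d (2 ^ i)
  set a := cesaroReal (1 - s / d) i
  have hv0 : 0 ≤ ((2 ^ i : ℕ) : ℝ) / d * s := by positivity
  have hv : ((2 ^ i : ℕ) : ℝ) / d * s = y ^ 2 := by rw [hy, Real.sq_sqrt hv0]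
  have hv' : 2 ^ i * (1 - (1 - s / d)) = y ^ 2 := by rw [← hv]; push_cast; ring
  rw [hv'] at ha1 ha2
  rw [hv] at hm
  have hy0 : 0 ≤ y := hy ▸ Real.sqrt_nonneg _
  have hq : 0 ≤ (d : ℝ) / (2 ^ i : ℕ) := by positivity
  rcases le_total y 1 with hy1 | hy1
  · have hmin : min y y⁻¹ = y := by
      rcases hy0.eq_or_lt with h0 | h0
      · simp [← h0]
      · exact min_eq_left (hy1.trans ((one_le_inv₀ h0).2 hy1))
    rw [hmin]
    have h1 : |m - a| ≤ 3 * y ^ 2 := by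
      rw [abs_le] at hm ⊢
      constructor <;> linarith
    have h2 : (m - a) ^ 2 ≤ (3 * y ^ 2) ^ 2 := sq_le_sq' (by linarith [(abs_le.1 h1).1])
      (abs_le.1 h1).2
    have h3 : (y ^ 2) ^ 2 ≤ y := by
      rw [← pow_mul]
      exact pow_le_of_le_one hy0 hy1 (by norm_num)
    nlinarith [mul_nonneg hC.le hy0, mul_nonneg hC.le hq]
  · have hyp : 0 < y := by linarith
    have hsp : 0 < s := hs0.lt_of_ne fun h0 => by
      rw [← h0, mul_zero] at hv
      nlinarith
    have hmin : min y y⁻¹ = y⁻¹ := min_eq_right ((inv_le_one_of_one_le₀ hy1).trans hy1)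
    rw [hmin]
    have h1 := hmC hsp
    rw [one_div] at h1
    have h2 : a ≤ y⁻¹ := by
      rw [inv_eq_one_div, le_div_iff₀ hyp]
      nlinarith [mul_nonneg (mul_nonneg ha0 hy0) (sub_nonneg.2 hy1)]
    have h3 : a ^ 2 ≤ y⁻¹ := by nlinarith
    have h4 : (m - a) ^ 2 ≤ 2 * m ^ 2 + 2 * a ^ 2 := by nlinarith [sq_nonneg (m + a)]
    have := inv_nonneg.2 hy0
    nlinarith

lemma sum_inv_mul_two_pow_le (F : Finset ℕ) {y : ℝ} (hy : 0 < y) (h : ∀ n ∈ F, 1 ≤ y * 2 ^ n) :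
    ∑ n ∈ F, (y * 2 ^ n)⁻¹ ≤ 2 := by
  rcases F.eq_empty_or_nonempty with rfl | hF
  · simp
  have h1 := h _ (F.min'_mem hF)
  set N := F.min' hF
  have hsub : F ⊆ Finset.Ico N (F.max' hF + 1) := fun n hn =>
    Finset.mem_Ico.2 ⟨F.min'_le n hn, Nat.lt_succ_of_le (F.le_max' n hn)⟩
  calc ∑ n ∈ F, (y * 2 ^ n)⁻¹ ≤ ∑ n ∈ Finset.Ico N (F.max' hF + 1), (y * 2 ^ n)⁻¹ :=
        Finset.sum_le_sum_of_subset_of_nonneg hsub fun _ _ _ => by positivity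
    _ = y⁻¹ * ∑ n ∈ Finset.Ico N (F.max' hF + 1), (2⁻¹ : ℝ) ^ n := by
        rw [Finset.mul_sum]
        exact Finset.sum_congr rfl fun n _ => by rw [mul_inv, inv_pow]
    _ ≤ y⁻¹ * ((2⁻¹ : ℝ) ^ N / (1 - 2⁻¹)) := by
        gcongr
        exact geom_sum_Ico_le_of_lt_one (by norm_num) (by norm_num)
    _ = 2 * (y * 2 ^ N)⁻¹ := by rw [mul_inv, inv_pow]; ring
    _ ≤ 2 := by linarith [inv_le_one_of_one_le₀ h1]

lemma sum_mul_two_pow_le (F : Finset ℕ) {y : ℝ} (hy : 0 < y) (h : ∀ n ∈ F, y * 2 ^ n ≤ 1) :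
    ∑ n ∈ F, y * 2 ^ n ≤ 2 := by
  rcases F.eq_empty_or_nonempty with rfl | hF
  · simp
  have h1 := h _ (F.max'_mem hF)
  set N := F.max' hF
  calc ∑ n ∈ F, y * 2 ^ n ≤ ∑ n ∈ Finset.range (N + 1), y * 2 ^ n :=
        Finset.sum_le_sum_of_subset_of_nonneg (fun n hn =>
          Finset.mem_range.2 (Nat.lt_succ_of_le (F.le_max' n hn))) fun _ _ _ => by positivity
    _ = y * (2 ^ (N + 1) - 1) := by
        rw [← Finset.mul_sum, geom_sum_eq (by norm_num)]
        norm_num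
    _ ≤ 2 := by rw [pow_succ]; nlinarith

lemma sum_min_inv_le (F : Finset ℕ) {y : ℝ} (hy : 0 ≤ y) :
    ∑ n ∈ F, min (y * 2 ^ n) (y * 2 ^ n)⁻¹ ≤ 4 := by
  rcases hy.eq_or_lt with rfl | hy
  · simp
  rw [← Finset.sum_filter_add_sum_filter_not F fun n => y * 2 ^ n ≤ 1]
  have h1 := sum_mul_two_pow_le (F.filter fun n => y * 2 ^ n ≤ 1) hy fun n hn =>
    (Finset.mem_filter.1 hn).2
  have h2 := sum_inv_mul_two_pow_le (F.filter fun n => ¬y * 2 ^ n ≤ 1) hy fun n hn =>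
    (not_le.1 (Finset.mem_filter.1 hn).2).le
  have h3 : ∑ n ∈ F.filter (fun n => y * 2 ^ n ≤ 1), min (y * 2 ^ n) (y * 2 ^ n)⁻¹ ≤
      ∑ n ∈ F.filter (fun n => y * 2 ^ n ≤ 1), y * 2 ^ n :=
    Finset.sum_le_sum fun _ _ => min_le_left _ _
  have h4 : ∑ n ∈ F.filter (fun n => ¬y * 2 ^ n ≤ 1), min (y * 2 ^ n) (y * 2 ^ n)⁻¹ ≤
      ∑ n ∈ F.filter (fun n => ¬y * 2 ^ n ≤ 1), (y * 2 ^ n)⁻¹ :=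
    Finset.sum_le_sum fun _ _ => min_le_right _ _
  linarith

lemma sum_div_four_pow_le {c : ℝ} (hc : 0 < c) {d : ℕ} (hd : 1 ≤ d) (F : Finset ℕ)
    (hF : ∀ n ∈ F, c * √d ≤ 2 ^ n) : ∑ n ∈ F, (d : ℝ) / (2 ^ (2 * n) : ℕ) ≤ 2 / c ^ 2 := by
  have hd0 : 0 < √(d : ℝ) := Real.sqrt_pos.2 (by positivity)
  have hy : ∀ n ∈ F, 1 ≤ (c * √d)⁻¹ * 2 ^ n := fun n hn => by
    rw [le_inv_mul_iff₀ (by positivity), mul_one]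
    exact hF n hn
  have h := sum_inv_mul_two_pow_le F (inv_pos.2 (mul_pos hc hd0)) hy
  have : ∀ n ∈ F, (d : ℝ) / (2 ^ (2 * n) : ℕ) ≤ 1 / c ^ 2 * ((c * √d)⁻¹ * 2 ^ n)⁻¹ := fun n hn => by
    have h1 : ((c * √d)⁻¹ * 2 ^ n)⁻¹ ^ 2 ≤ ((c * √d)⁻¹ * 2 ^ n)⁻¹ :=
      pow_le_of_le_one (inv_nonneg.2 (zero_le_one.trans (hy n hn)))
        (inv_le_one_of_one_le₀ (hy n hn)) two_ne_zero
    refine le_trans (le_of_eq ?_) (mul_le_mul_of_nonneg_left h1 (by positivity))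
    have h2 : (d : ℝ) = √d ^ 2 := (Real.sq_sqrt d.cast_nonneg).symm
    rw [Nat.cast_pow, pow_mul']
    conv_lhs => rw [h2]
    field_simp
    norm_num
  refine (Finset.sum_le_sum this).trans ?_
  rw [← Finset.mul_sum, div_eq_mul_one_div 2, mul_comm 2]
  gcongr

lemma exists_sum_symbolAt_sq_le {c : ℝ} (hc : 0 < c) : ∃ C : ℝ, 0 < C ∧ ∀ (d : ℕ), 1 ≤ d →
    ∀ (F : Finset ℕ), (∀ n ∈ F, c * √d ≤ 2 ^ n) → ∀ φ : Fin d → ℝ,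
      ∑ n ∈ F, ‖symbolAt φ (ballElt d (2 ^ (2 * n)) - cesaro (lazyWalk d) (2 * n))‖ ^ 2 ≤ C := by
  obtain ⟨C, hC, h⟩ := exists_multiplier_sub_cesaroReal_sq_le
  refine ⟨C * (4 + 2 / c ^ 2), by positivity, fun d hd F hF φ => ?_⟩
  set s := ∑ j, Real.sin (φ j / 2) ^ 2 with hs
  have hs0 : 0 ≤ s := Finset.sum_nonneg fun j _ => sq_nonneg _
  have hy : ∀ n : ℕ, √(s / d) * 2 ^ n = √((2 ^ (2 * n) : ℕ) / d * s) := fun n => by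
    rw [Nat.cast_pow, pow_mul', div_mul_eq_mul_div, mul_div_assoc,
      Real.sqrt_mul (by positivity), Real.sqrt_sq (by positivity)]
    push_cast
    ring
  calc _ ≤ ∑ n ∈ F, C * (min (√(s / d) * 2 ^ n) (√(s / d) * 2 ^ n)⁻¹ + d / (2 ^ (2 * n) : ℕ)) := by
        refine Finset.sum_le_sum fun n _ => ?_
        rw [map_sub, symbolAt_ballElt, symbolAt_cesaro (symbolAt_lazyWalk hd φ),
          ← Complex.ofReal_sub, Complex.norm_real, Real.norm_eq_abs, sq_abs]
        exact h d (2 * n) φ hd _ (hy n)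
    _ ≤ _ := by
        rw [← Finset.mul_sum, Finset.sum_add_distrib]
        gcongr
        · exact sum_min_inv_le F (Real.sqrt_nonneg _)
        · exact sum_div_four_pow_le hc hd F hF

/-- The linearized maximal inequality for finitely supported nonnegative functions. -/
lemma exists_sum_sq_ballElt_le {c : ℝ} (hc : 0 < c) : ∃ C : ℝ, 0 < C ∧ ∀ (d : ℕ), 1 ≤ d →
    ∀ (F : Finset ℕ), (∀ n ∈ F, c * √d ≤ 2 ^ n) →
    ∀ (X Y : Finset (Fin d → ℤ)) (f : (Fin d → ℤ) → ℝ) (ι : (Fin d → ℤ) → ℕ),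
      (∀ y, 0 ≤ f y) → (∀ x ∈ X, ι x ∈ F) →
      ∑ x ∈ X, (∑ y ∈ Y, (ballElt d (2 ^ (2 * ι x))).coeff (x - y) * f y) ^ 2 ≤
        C * ∑ y ∈ Y, f y ^ 2 := by
  classical
  obtain ⟨C, hC, h⟩ := exists_sum_symbolAt_sq_le hc
  refine ⟨36 + 2 * C, by positivity, fun d hd F hF X Y f ι hf hι => ?_⟩
  set Q : AddMonoidAlgebra ℝ (Fin d → ℤ) := ∑ y ∈ Y, AddMonoidAlgebra.single y (f y) with hQ
  set D : ℕ → AddMonoidAlgebra ℝ (Fin d → ℤ) := fun n =>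
    ballElt d (2 ^ (2 * n)) - cesaro (lazyWalk d) (2 * n) with hD
  have hQc : ∀ x, Q.coeff x = if x ∈ Y then f x else 0 := fun x => by
    rw [hQ, AddMonoidAlgebra.coeff_sum, Finsupp.finsetSum_apply]
    simp only [AddMonoidAlgebra.coeff_single, Finsupp.single_apply, Finset.sum_ite_eq']
  have hQs : (Q.coeff.sum fun _ a => a ^ 2) ≤ ∑ y ∈ Y, f y ^ 2 := by
    rw [Finsupp.sum_of_support_subset _ (s := Y) _ _ fun _ _ => by simp]
    · exact Finset.sum_le_sum fun y hy => by rw [hQc, if_pos hy]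
    · intro x hx
      by_contra hxY
      rw [Finsupp.mem_support_iff, hQc, if_neg hxY] at hx
      exact hx rfl
  have hsq : ∑ n ∈ F, ((D n * Q).coeff.sum fun _ a => a ^ 2) ≤ C * ∑ y ∈ Y, f y ^ 2 := by
    refine (sum_sq_le_of_symbolAt_le F (fun n => D n * Q) Q C fun φ => ?_).trans
      (mul_le_mul_of_nonneg_left hQs hC.le)
    simp_rw [map_mul, norm_mul, mul_pow]
    rw [← Finset.sum_mul]
    gcongr
    exact h d hd F hF φ
  have hB : ∑ x ∈ X, ((D (ι x) * Q).coeff x) ^ 2 ≤ C * ∑ y ∈ Y, f y ^ 2 := by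
    refine le_trans ?_ hsq
    calc _ ≤ ∑ x ∈ X, ∑ n ∈ F, ((D n * Q).coeff x) ^ 2 := Finset.sum_le_sum fun x hx =>
          Finset.single_le_sum (f := fun n => ((D n * Q).coeff x) ^ 2)
            (fun n _ => sq_nonneg _) (hι x hx)
      _ = ∑ n ∈ F, ∑ x ∈ X, ((D n * Q).coeff x) ^ 2 := Finset.sum_comm
      _ ≤ _ := by
        refine Finset.sum_le_sum fun n _ => ?_
        rw [Finsupp.sum_of_support_subset _ (s := X ∪ (D n * Q).coeff.support)
          Finset.subset_union_right _ fun _ _ => by simp]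
        exact Finset.sum_le_sum_of_subset_of_nonneg Finset.subset_union_left
          fun _ _ _ => sq_nonneg _
  have hA := maximalBound_cesaro (coeff_lazyWalk_nonneg d) (coeff_lazyWalk_neg d)
    (lift_one_lazyWalk hd) (X.sup fun x => 2 * ι x) X Y f (fun x => 2 * ι x) hf
    fun x hx => Finset.le_sup (f := fun x => 2 * ι x) hx
  calc _ ≤ ∑ x ∈ X, (2 * (∑ y ∈ Y, (cesaro (lazyWalk d) (2 * ι x)).coeff (x - y) * f y) ^ 2 +
        2 * ((D (ι x) * Q).coeff x) ^ 2) := by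
        refine Finset.sum_le_sum fun x _ => ?_
        rw [hQ, coeff_mul_sum_single]
        have : ∑ y ∈ Y, (ballElt d (2 ^ (2 * ι x))).coeff (x - y) * f y =
            ∑ y ∈ Y, (cesaro (lazyWalk d) (2 * ι x)).coeff (x - y) * f y +
              ∑ y ∈ Y, (D (ι x)).coeff (x - y) * f y := by
          rw [← Finset.sum_add_distrib]
          refine Finset.sum_congr rfl fun y _ => ?_
          rw [hD, AddMonoidAlgebra.coeff_sub, Finsupp.sub_apply]
          ring
        rw [this]
        nlinarith [sq_nonneg (∑ y ∈ Y, (cesaro (lazyWalk d) (2 * ι x)).coeff (x - y) * f y -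
          ∑ y ∈ Y, (D (ι x)).coeff (x - y) * f y)]
    _ ≤ _ := by
        rw [Finset.sum_add_distrib, ← Finset.mul_sum, ← Finset.mul_sum]
        linarith

end SquareFunction

lemma latticeBallSet_two_pow (d n : ℕ) :
    latticeBallSet d ((2 : ℝ) ^ n) = latticeBall d (2 ^ (2 * n)) := by
  ext x
  rw [Finset.mem_coe, mem_latticeBall, latticeBallSet, Set.mem_ofPred_eq, ← cast_latticeNormSq,
    ← pow_mul, mul_comm n 2]
  norm_cast

lemma norm_ballAvg_le {d n : ℕ} (f : (Fin d → ℤ) → ℂ) (x : Fin d → ℤ) (Y : Finset (Fin d → ℤ))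
    (hY : ∀ z ∈ latticeBall d (2 ^ (2 * n)), x - z ∈ Y) :
    ‖ballAvg d ((2 : ℝ) ^ n) f x‖ ≤
      ∑ y ∈ Y, (ballElt d (2 ^ (2 * n))).coeff (x - y) * ‖f y‖ := by
  classical
  have hc := ballCount_pos d (2 ^ (2 * n))
  rw [ballAvg, latticeBallSet_two_pow, finsum_mem_coe_finset, Set.ncard_coe_finset, norm_div,
    Complex.norm_natCast, div_eq_inv_mul, ← ballCount]
  calc _ ≤ (ballCount d (2 ^ (2 * n)))⁻¹ * ∑ z ∈ latticeBall d (2 ^ (2 * n)), ‖f (x - z)‖ := by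
        gcongr
        exact norm_sum_le _ _
    _ = ∑ z ∈ latticeBall d (2 ^ (2 * n)),
        (ballElt d (2 ^ (2 * n))).coeff (x - (x - z)) * ‖f (x - z)‖ := by
        rw [Finset.mul_sum]
        refine Finset.sum_congr rfl fun z hz => ?_
        rw [_root_.sub_sub_cancel, coeff_ballElt, if_pos hz]
    _ = ∑ y ∈ (latticeBall d (2 ^ (2 * n))).image (fun z => x - z),
        (ballElt d (2 ^ (2 * n))).coeff (x - y) * ‖f y‖ :=
        (Finset.sum_image (f := fun y => (ballElt d (2 ^ (2 * n))).coeff (x - y) * ‖f y‖)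
          fun a _ b _ h => sub_right_injective h).symm
    _ ≤ _ := by
        refine Finset.sum_le_sum_of_subset_of_nonneg (Finset.image_subset_iff.2 hY)
          fun y _ _ => mul_nonneg ?_ (norm_nonneg _)
        rw [coeff_ballElt]
        split_ifs
        · positivity
        · exact le_rfl

/-- Dimension-free `ℓ₂` bound for the discrete dyadic Hardy–Littlewood
maximal operator with the supremum restricted to dyadic radii
`c₁ d^{1/2} ≤ N = 2^n ≤ c₂ d` (the intermediate-scale case). -/
theorem dimension_free_intermediate_scale (c₁ c₂ : ℝ) (hc₁ : 0 < c₁) (hc₂ : 0 < c₂) :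
    ∃ C : ℝ, 0 < C ∧
      ∀ d : ℕ, 1 ≤ d → ∀ f : (Fin d → ℤ) → ℂ,
        lpNorm d 2
            (fun x => ⨆ (n : ℕ)
              (_ : c₁ * Real.sqrt d ≤ (2 : ℝ) ^ n) (_ : (2 : ℝ) ^ n ≤ c₂ * d),
              (‖ballAvg d ((2 : ℝ) ^ n) f x‖₊ : ℝ≥0∞)) ≤
          ENNReal.ofReal C * lpNorm d 2 (fun x => (‖f x‖₊ : ℝ≥0∞)) := by
  classical
  obtain ⟨C, hC, h⟩ := exists_sum_sq_ballElt_le hc₁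
  refine ⟨√C, Real.sqrt_pos.2 hC, fun d hd f => ?_⟩
  set F : Finset ℕ := (Finset.range (⌈c₂ * d⌉₊ + 1)).filter fun n =>
    c₁ * √d ≤ 2 ^ n ∧ (2 : ℝ) ^ n ≤ c₂ * d with hF
  have hmem : ∀ n : ℕ, c₁ * √d ≤ (2 : ℝ) ^ n → (2 : ℝ) ^ n ≤ c₂ * d → n ∈ F := fun n h1 h2 => by
    refine Finset.mem_filter.2 ⟨Finset.mem_range.2 (Nat.lt_succ_of_le ?_), h1, h2⟩
    have h3 : ((2 ^ n : ℕ) : ℝ) ≤ ⌈c₂ * d⌉₊ := by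
      push_cast
      exact h2.trans (Nat.le_ceil _)
    exact Nat.lt_two_pow_self.le.trans (Nat.cast_le.1 h3)
  set S : (Fin d → ℤ) → ℝ≥0∞ := fun x => ⨆ (n : ℕ)
    (_ : c₁ * Real.sqrt d ≤ (2 : ℝ) ^ n) (_ : (2 : ℝ) ^ n ≤ c₂ * d),
    (‖ballAvg d ((2 : ℝ) ^ n) f x‖₊ : ℝ≥0∞) with hS
  have hSq : ∑' x, S x ^ (2 : ℝ) ≤ ENNReal.ofReal C * ∑' x, (‖f x‖₊ : ℝ≥0∞) ^ (2 : ℝ) := by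
    simp_rw [ENNReal.rpow_two]
    rcases F.eq_empty_or_nonempty with hF0 | hFne
    · have hS0 : ∀ x, S x = 0 := fun x => by
        refine le_antisymm (iSup_le fun n => iSup₂_le fun h1 h2 => ?_) zero_le
        simpa [hF0] using hmem n h1 h2
      simp [hS0]
    choose ι hιF hι using fun x : Fin d → ℤ =>
      F.exists_max_image (fun n => ‖ballAvg d ((2 : ℝ) ^ n) f x‖₊) hFne
    rw [ENNReal.tsum_eq_iSup_sum]
    refine iSup_le fun X => ?_
    set Y : Finset (Fin d → ℤ) := X.biUnion fun x => F.biUnion fun n =>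
      (latticeBall d (2 ^ (2 * n))).image fun z => x - z with hY
    have hle : ∀ x ∈ X, S x ≤ ENNReal.ofReal
        (∑ y ∈ Y, (ballElt d (2 ^ (2 * ι x))).coeff (x - y) * ‖f y‖) := fun x hx => by
      refine iSup_le fun n => iSup₂_le fun h1 h2 => ?_
      refine (ENNReal.coe_le_coe.2 (hι x n (hmem n h1 h2))).trans ?_
      rw [← enorm_eq_nnnorm, ← ofReal_norm]
      refine ENNReal.ofReal_le_ofReal (norm_ballAvg_le f x Y fun z hz => ?_)
      exact Finset.mem_biUnion.2 ⟨x, hx, Finset.mem_biUnion.2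
        ⟨ι x, hιF x, Finset.mem_image_of_mem _ hz⟩⟩
    have hnn : ∀ x, 0 ≤ ∑ y ∈ Y, (ballElt d (2 ^ (2 * ι x))).coeff (x - y) * ‖f y‖ := fun x =>
      Finset.sum_nonneg fun y _ => by
        rw [coeff_ballElt]
        have := ballCount_pos d (2 ^ (2 * ι x))
        split_ifs <;> positivity
    calc ∑ x ∈ X, S x ^ 2 ≤ ∑ x ∈ X, ENNReal.ofReal
          ((∑ y ∈ Y, (ballElt d (2 ^ (2 * ι x))).coeff (x - y) * ‖f y‖) ^ 2) := by
          refine Finset.sum_le_sum fun x hx => ?_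
          rw [ENNReal.ofReal_pow (hnn x)]
          exact pow_le_pow_left' (hle x hx) 2
      _ = ENNReal.ofReal (∑ x ∈ X,
          (∑ y ∈ Y, (ballElt d (2 ^ (2 * ι x))).coeff (x - y) * ‖f y‖) ^ 2) :=
          (ENNReal.ofReal_sum_of_nonneg fun x _ => sq_nonneg _).symm
      _ ≤ ENNReal.ofReal (C * ∑ y ∈ Y, ‖f y‖ ^ 2) :=
          ENNReal.ofReal_le_ofReal (h d hd F (fun n hn => (Finset.mem_filter.1 hn).2.1) X Y
            (fun y => ‖f y‖) ι (fun y => norm_nonneg _) fun x _ => hιF x)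
      _ = ENNReal.ofReal C * ∑ y ∈ Y, (‖f y‖₊ : ℝ≥0∞) ^ 2 := by
          rw [ENNReal.ofReal_mul hC.le, ENNReal.ofReal_sum_of_nonneg fun x _ => sq_nonneg _]
          congr 1
          refine Finset.sum_congr rfl fun y _ => ?_
          rw [ENNReal.ofReal_pow (norm_nonneg _), ofReal_norm, enorm_eq_nnnorm]
      _ ≤ _ := by
          gcongr
          exact ENNReal.sum_le_tsum Y
  rw [_root_.lpNorm, _root_.lpNorm]
  refine (ENNReal.rpow_le_rpow hSq (by norm_num)).trans (le_of_eq ?_)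
  rw [ENNReal.mul_rpow_of_nonneg _ _ (by norm_num), ENNReal.ofReal_rpow_of_nonneg hC.le
    (by norm_num), Real.sqrt_eq_rpow]
end

section
/- There exist constants C₁, C₂ > 0 such that for every dimension d ≥ 1 and every real N ≥ C₁ d, the number of lattice points in the Euclidean ball of radius N satisfies C₂^{−1} |B_N| ≤ #(B_N ∩ ℤ^d) ≤ 2 e^{1/(8C₁²)} |B_N|, where |B_N| denotes the d-dimensional Lebesgue measure of B_N. (Lemma 3.12.) -/
open MeasureTheory

/-- The closed Euclidean ball of radius `N` centered at the origin of `ℝ^d`. -/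
def euclideanBall (d : ℕ) (N : ℝ) : Set (Fin d → ℝ) :=
  {x | ∑ j, (x j) ^ 2 ≤ N ^ 2}

section BasicProperties

variable {d : ℕ} {N : ℝ}

theorem measurableSet_euclideanBall : MeasurableSet (euclideanBall d N) :=
  measurableSet_le (by fun_prop) measurable_const

theorem volume_euclideanBall_lt_top : volume (euclideanBall d N) < ⊤ := by
  refine (measure_mono (t := Set.Icc (fun _ => -|N|) (fun _ => |N|)) fun x hx => ?_).trans_lt
    isCompact_Icc.measure_lt_top
  have h : ∀ j, |x j| ≤ |N| := fun j => sq_le_sq.1 <|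
    (Finset.single_le_sum (f := fun j => x j ^ 2) (fun i _ => sq_nonneg _)
      (Finset.mem_univ j)).trans hx
  exact ⟨fun j => (abs_le.1 (h j)).1, fun j => (abs_le.1 (h j)).2⟩

theorem finite_latticeBallSet : (latticeBallSet d N).Finite := by
  refine (Set.finite_Icc (fun _ => -⌈|N|⌉) (fun _ => ⌈|N|⌉)).subset fun y hy => ?_
  have h : ∀ j, |(y j : ℝ)| ≤ (⌈|N|⌉ : ℤ) := fun j => (sq_le_sq.1 <|
    (Finset.single_le_sum (f := fun j => (y j : ℝ) ^ 2) (fun i _ => sq_nonneg _)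
      (Finset.mem_univ j)).trans hy).trans (Int.le_ceil _)
  have h' : ∀ j, |y j| ≤ ⌈|N|⌉ := fun j => by exact_mod_cast h j
  exact ⟨fun j => (abs_le.1 (h' j)).1, fun j => (abs_le.1 (h' j)).2⟩

end BasicProperties

open scoped Pointwise in
theorem volume_euclideanBall_mul (d : ℕ) (N : ℝ) {c : ℝ} (hc : 0 < c) :
    (volume (euclideanBall d (c * N))).toReal =
      c ^ d * (volume (euclideanBall d N)).toReal := by
  have h : euclideanBall d (c * N) = c • euclideanBall d N := by
    ext x
    rw [Set.mem_smul_set_iff_inv_smul_mem₀ hc.ne']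
    simp only [euclideanBall, Set.mem_ofPred_eq, Pi.smul_apply, smul_eq_mul, mul_pow,
      ← Finset.mul_sum]
    rw [inv_pow, inv_mul_le_iff₀ (by positivity)]
  rw [h, Measure.addHaar_smul, ENNReal.toReal_mul, ENNReal.toReal_ofReal (abs_nonneg _)]
  simp [abs_of_pos hc]

section UpperBound

/-- The open unit cube centered at the origin. -/
def centeredCube (d : ℕ) : Set (Fin d → ℝ) :=
  Set.pi Set.univ fun _ => Set.Ioo (-(1 / 2)) (1 / 2)

theorem measurableSet_centeredCube (d : ℕ) : MeasurableSet (centeredCube d) :=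
  MeasurableSet.univ_pi fun _ => measurableSet_Ioo

theorem volume_centeredCube (d : ℕ) : volume (centeredCube d) = 1 := by
  rw [centeredCube, volume_pi_pi]
  norm_num

theorem one_le_two_mul_volume_translate_inter {d : ℕ} {N R : ℝ} (hR : N ^ 2 + d / 4 ≤ R ^ 2)
    {y : Fin d → ℝ} (hy : y ∈ euclideanBall d N) :
    1 ≤ 2 * volume ((fun x => x - y) ⁻¹' centeredCube d ∩ euclideanBall d R) := by
  set A : Set (Fin d → ℝ) := centeredCube d ∩ (fun z => z + y) ⁻¹' euclideanBall d R with hA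
  have hvol : volume ((fun x => x - y) ⁻¹' centeredCube d ∩ euclideanBall d R) = volume A := by
    rw [← measure_preimage_add_right volume y]
    congr 1
    ext z
    simp [hA]
  have hneg : volume (-A) = volume A := Measure.measure_neg _ _
  rw [hvol, two_mul]
  nth_rewrite 2 [← hneg]
  rw [← volume_centeredCube d]
  refine (measure_mono fun z hz => ?_).trans (measure_union_le A (-A))
  have hz' : ∀ j, -(1 / 2) < z j ∧ z j < 1 / 2 := fun j => hz j (Set.mem_univ j)
  have hzn : -z ∈ centeredCube d := fun j _ =>
    ⟨by simpa using neg_lt_neg (hz' j).2, by simpa using neg_lt_neg (hz' j).1⟩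
  have hsq : ∑ j, z j ^ 2 ≤ d / 4 := by
    calc ∑ j, z j ^ 2 ≤ ∑ _j : Fin d, (1 / 4 : ℝ) :=
          Finset.sum_le_sum fun j _ => by nlinarith [hz' j]
      _ = d / 4 := by simp; ring
  have hy' : ∑ j, y j ^ 2 ≤ N ^ 2 := hy
  rcases le_total (∑ j, z j * y j) 0 with h | h
  · refine Or.inl ⟨hz, ?_⟩
    have e : ∑ j, (z j + y j) ^ 2 = ∑ j, z j ^ 2 + 2 * ∑ j, z j * y j + ∑ j, y j ^ 2 := by
      simp only [Finset.mul_sum, ← Finset.sum_add_distrib]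
      exact Finset.sum_congr rfl fun j _ => by ring
    change ∑ j, (z j + y j) ^ 2 ≤ R ^ 2
    linarith
  · refine Or.inr ⟨hzn, ?_⟩
    have e : ∑ j, (-z j + y j) ^ 2 = ∑ j, z j ^ 2 - 2 * ∑ j, z j * y j + ∑ j, y j ^ 2 := by
      simp only [Finset.mul_sum, ← Finset.sum_add_distrib, ← Finset.sum_sub_distrib]
      exact Finset.sum_congr rfl fun j _ => by ring
    change ∑ j, (-z j + y j) ^ 2 ≤ R ^ 2
    linarith

theorem ncard_latticeBallSet_le_two_mul_volume {d : ℕ} {N R : ℝ}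
    (hR : N ^ 2 + d / 4 ≤ R ^ 2) :
    ((latticeBallSet d N).ncard : ℝ) ≤ 2 * (volume (euclideanBall d R)).toReal := by
  set L := (finite_latticeBallSet (d := d) (N := N)).toFinset
  let cell : (Fin d → ℤ) → Set (Fin d → ℝ) := fun y =>
    (fun x => x - fun j => (y j : ℝ)) ⁻¹' centeredCube d ∩ euclideanBall d R
  have hmeas : ∀ y, MeasurableSet (cell y) := fun y =>
    ((measurableSet_centeredCube d).preimage (by fun_prop)).inter measurableSet_euclideanBall
  have hdisj : Set.PairwiseDisjoint (L : Set (Fin d → ℤ)) cell := by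
    intro y _ y' _ hne
    refine Set.disjoint_left.2 fun x hx hx' => hne (funext fun j => ?_)
    have h : -(1 / 2) < x j - y j ∧ x j - y j < 1 / 2 := hx.1 j (Set.mem_univ j)
    have h' : -(1 / 2) < x j - y' j ∧ x j - y' j < 1 / 2 := hx'.1 j (Set.mem_univ j)
    have h1 : (y j : ℝ) < y' j + 1 := by linarith
    have h2 : (y' j : ℝ) < y j + 1 := by linarith
    norm_cast at h1 h2
    omega
  have key : (L.card : ENNReal) ≤ 2 * volume (euclideanBall d R) := by
    calc (L.card : ENNReal) = ∑ _y ∈ L, 1 := by simp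
      _ ≤ ∑ y ∈ L, 2 * volume (cell y) := Finset.sum_le_sum fun y hy =>
          one_le_two_mul_volume_translate_inter hR
            ((finite_latticeBallSet (d := d) (N := N)).mem_toFinset.1 hy)
      _ = 2 * volume (⋃ y ∈ L, cell y) := by
          rw [← Finset.mul_sum, measure_biUnion_finset hdisj fun y _ => hmeas y]
      _ ≤ 2 * volume (euclideanBall d R) := by
          gcongr
          exact Set.iUnion₂_subset fun y _ => Set.inter_subset_right
  rw [Set.ncard_eq_toFinset_card _ finite_latticeBallSet]
  have := ENNReal.toReal_mono
    (ENNReal.mul_ne_top ENNReal.ofNat_ne_top volume_euclideanBall_lt_top.ne) key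
  simpa using this

theorem ncard_latticeBallSet_le {C : ℝ} (hC : 0 < C) {d : ℕ} (hd : 1 ≤ d) {N : ℝ}
    (hN : C * d ≤ N) :
    ((latticeBallSet d N).ncard : ℝ) ≤
      2 * Real.exp (1 / (8 * C ^ 2)) * (volume (euclideanBall d N)).toReal := by
  have hd' : (1 : ℝ) ≤ d := by exact_mod_cast hd
  have hN0 : 0 < N := lt_of_lt_of_le (by positivity) hN
  set t : ℝ := d / (8 * N ^ 2) with ht
  have hexp : 1 + 2 * t ≤ Real.exp t ^ 2 := by
    rw [← Real.exp_nat_mul]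
    push_cast
    linarith [Real.add_one_le_exp (2 * t)]
  have hR : N ^ 2 + d / 4 ≤ (Real.exp t * N) ^ 2 := by
    rw [mul_pow]
    calc N ^ 2 + d / 4 = (1 + 2 * t) * N ^ 2 := by rw [ht]; field_simp; ring
      _ ≤ _ := by gcongr
  have hpow : Real.exp t ^ d ≤ Real.exp (1 / (8 * C ^ 2)) := by
    rw [← Real.exp_nat_mul, Real.exp_le_exp, ht]
    have : (C * d) ^ 2 ≤ N ^ 2 := by gcongr
    rw [mul_div_assoc', div_le_div_iff₀ (by positivity) (by positivity)]
    nlinarith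
  calc ((latticeBallSet d N).ncard : ℝ)
      ≤ 2 * (volume (euclideanBall d (Real.exp t * N))).toReal :=
        ncard_latticeBallSet_le_two_mul_volume hR
    _ = 2 * (Real.exp t ^ d * (volume (euclideanBall d N)).toReal) := by
        rw [volume_euclideanBall_mul d N (Real.exp_pos t)]
    _ ≤ 2 * (Real.exp (1 / (8 * C ^ 2)) * (volume (euclideanBall d N)).toReal) := by gcongr
    _ = _ := by ring

end UpperBound

section LowerBound

open ProbabilityTheory

/-- The uniform probability measure on the unit interval `[0, 1)`. -/
noncomputable def unitIcoMeasure : Measure ℝ := volume.restrict (Set.Ico 0 1)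

instance : IsProbabilityMeasure unitIcoMeasure := ⟨by simp [unitIcoMeasure]⟩

theorem ae_unitIcoMeasure_floor_add_mem (x : ℝ) :
    ∀ᵐ u ∂unitIcoMeasure, (⌊x + u⌋ : ℝ) ∈ Set.Icc (⌊x⌋ : ℝ) (⌊x⌋ + 1) := by
  refine (ae_restrict_iff' measurableSet_Ico).2 (ae_of_all _ fun u hu => ?_)
  have h1 : ⌊x⌋ ≤ ⌊x + u⌋ := Int.floor_mono (by linarith [hu.1])
  have h2 : ⌊x + u⌋ ≤ ⌊x⌋ + 1 := by
    rw [← Int.floor_add_one]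
    exact Int.floor_mono (by linarith [hu.2])
  exact ⟨by exact_mod_cast h1, by exact_mod_cast h2⟩

theorem measurable_floor_add (x : ℝ) : Measurable fun u : ℝ => (⌊x + u⌋ : ℝ) := by
  fun_prop

theorem memLp_floor_add (x : ℝ) : MemLp (fun u : ℝ => (⌊x + u⌋ : ℝ)) 2 unitIcoMeasure :=
  memLp_of_bounded (ae_unitIcoMeasure_floor_add_mem x)
    (measurable_floor_add x).aestronglyMeasurable 2

theorem integral_floor_add (x : ℝ) : ∫ u, (⌊x + u⌋ : ℝ) ∂unitIcoMeasure = x := by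
  have hf0 := Int.fract_nonneg x
  have hf1 := Int.fract_lt_one x
  have hx := Int.floor_add_fract x
  have h : (fun u : ℝ => (⌊x + u⌋ : ℝ)) =ᵐ[unitIcoMeasure]
      fun u => (⌊x⌋ : ℝ) + (Set.Ici (1 - Int.fract x)).indicator (fun _ => (1 : ℝ)) u := by
    refine (ae_restrict_iff' measurableSet_Ico).2 (ae_of_all _ fun u hu => ?_)
    by_cases hu' : 1 - Int.fract x ≤ u
    · have : ⌊x + u⌋ = ⌊x⌋ + 1 := Int.floor_eq_iff.2
        ⟨by push_cast; linarith, by push_cast; linarith [hu.2]⟩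
      simp [this, hu']
    · have : ⌊x + u⌋ = ⌊x⌋ := Int.floor_eq_iff.2
        ⟨by linarith [hu.1], by linarith⟩
      simp only [this, Set.indicator, Set.mem_Ici, hu', if_false, add_zero]
  have hvol : unitIcoMeasure.real (Set.Ici (1 - Int.fract x)) = Int.fract x := by
    have : Set.Ici (1 - Int.fract x) ∩ Set.Ico 0 1 = Set.Ico (1 - Int.fract x) 1 := by
      ext u
      simp only [Set.mem_inter_iff, Set.mem_Ici, Set.mem_Ico]
      constructor
      · rintro ⟨h, _, h'⟩; exact ⟨h, h'⟩
      · rintro ⟨h, h'⟩; exact ⟨h, by linarith, h'⟩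
    rw [Measure.real, unitIcoMeasure, Measure.restrict_apply measurableSet_Ici, this]
    simp [hf0]
  rw [integral_congr_ae h, integral_add (integrable_const _)
    ((integrable_const _).indicator measurableSet_Ici), integral_indicator_const _ measurableSet_Ici,
    hvol]
  simp

/-- The uniform probability measure on the unit cube `[0, 1)^d`. -/
noncomputable def unitCubeMeasure (d : ℕ) : Measure (Fin d → ℝ) :=
  Measure.pi fun _ => unitIcoMeasure

instance (d : ℕ) : IsProbabilityMeasure (unitCubeMeasure d) := by
  unfold unitCubeMeasure; infer_instance

/-- The coordinatewise floor of a real vector. -/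
noncomputable def floorVec {d : ℕ} (x : Fin d → ℝ) : Fin d → ℤ := fun j => ⌊x j⌋

theorem measurable_floorVec (d : ℕ) : Measurable (floorVec (d := d)) :=
  measurable_pi_lambda _ fun j => Int.measurable_floor.comp (measurable_pi_apply j)

theorem ae_unitCubeMeasure_floor_add_mem {d : ℕ} (x : Fin d → ℝ) :
    ∀ᵐ u ∂unitCubeMeasure d, ∀ j, (⌊x j + u j⌋ : ℝ) ∈ Set.Icc (⌊x j⌋ : ℝ) (⌊x j⌋ + 1) :=
  ae_all_iff.2 fun j =>
    (measurePreserving_eval (fun _ : Fin d => unitIcoMeasure) j).quasiMeasurePreserving.ae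
      (ae_unitIcoMeasure_floor_add_mem (x j))

theorem unitCubeMeasure_le_abs_sum_floor_sub {d : ℕ} {N : ℝ} (hN : 0 < N) {x : Fin d → ℝ}
    (hx : x ∈ euclideanBall d N) :
    unitCubeMeasure d {u | N ≤ |∑ j, x j * ⌊x j + u j⌋ - ∑ j, x j ^ 2|} ≤
      ENNReal.ofReal (1 / 4) := by
  have hx' : ∑ j, x j ^ 2 ≤ N ^ 2 := hx
  let X : Fin d → ℝ → ℝ := fun j u => x j * ⌊x j + u⌋
  have hX : ∀ j, MemLp (X j) 2 unitIcoMeasure := fun j => (memLp_floor_add (x j)).const_mul (x j)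
  have hXpi : ∀ j, MemLp (fun u : Fin d → ℝ => X j (u j)) 2 (unitCubeMeasure d) := fun j =>
    (hX j).comp_measurePreserving (measurePreserving_eval _ j)
  let S : (Fin d → ℝ) → ℝ := ∑ j, fun u => X j (u j)
  have hS : MemLp S 2 (unitCubeMeasure d) := memLp_finsetSum' _ fun j _ => hXpi j
  have hSapp : ∀ u, S u = ∑ j, x j * ⌊x j + u j⌋ := fun u => by simp [S, X]
  have hmean : ∫ u, S u ∂unitCubeMeasure d = ∑ j, x j ^ 2 := by
    simp only [hSapp]
    rw [integral_finsetSum _ fun j _ => (hXpi j).integrable one_le_two]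
    refine Finset.sum_congr rfl fun j _ => ?_
    rw [unitCubeMeasure, integral_comp_eval (μ := fun _ : Fin d => unitIcoMeasure) (f := X j)
      (hX j).aestronglyMeasurable]
    simp only [X]
    rw [integral_const_mul, integral_floor_add, sq]
  have hvar : variance S (unitCubeMeasure d) ≤ N ^ 2 / 4 := by
    calc variance S (unitCubeMeasure d) = ∑ j, variance (X j) unitIcoMeasure :=
          variance_sum_pi hX
      _ ≤ ∑ j, x j ^ 2 * (1 / 4) := Finset.sum_le_sum fun j _ => by
          simp only [X]
          rw [variance_const_mul]
          gcongr
          refine (variance_le_sq_of_bounded (ae_unitIcoMeasure_floor_add_mem (x j))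
            (measurable_floor_add _).aemeasurable).trans (le_of_eq ?_)
          ring
      _ ≤ N ^ 2 / 4 := by rw [← Finset.sum_mul]; linarith
  have h := meas_ge_le_variance_div_sq hS hN
  rw [hmean] at h
  simp only [hSapp] at h
  refine h.trans (ENNReal.ofReal_le_ofReal ?_)
  rw [div_le_iff₀ (by positivity)]
  linarith

theorem three_quarters_le_unitCubeMeasure_floorVec_mem {d : ℕ} {N M : ℝ} (hN : 0 < N)
    (hM : M ^ 2 + 2 * N + d ≤ N ^ 2) {x : Fin d → ℝ} (hx : x ∈ euclideanBall d M) :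
    ENNReal.ofReal (3 / 4) ≤ unitCubeMeasure d {u | floorVec (x + u) ∈ latticeBallSet d N} := by
  have hx' : ∑ j, x j ^ 2 ≤ M ^ 2 := hx
  have hxN : x ∈ euclideanBall d N := by
    change ∑ j, x j ^ 2 ≤ N ^ 2
    have : (0 : ℝ) ≤ d := by positivity
    linarith
  set E : Set (Fin d → ℝ) := {u | N ≤ |∑ j, x j * ⌊x j + u j⌋ - ∑ j, x j ^ 2|} with hE
  have hEmeas : MeasurableSet E := measurableSet_le measurable_const (by fun_prop)
  have hcompl : ENNReal.ofReal (3 / 4) ≤ unitCubeMeasure d Eᶜ := by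
    rw [prob_compl_eq_one_sub hEmeas]
    refine le_trans ?_ (tsub_le_tsub_left (unitCubeMeasure_le_abs_sum_floor_sub hN hxN) 1)
    rw [← ENNReal.ofReal_one, ← ENNReal.ofReal_sub _ (by norm_num)]
    norm_num
  refine hcompl.trans (measure_mono_ae ?_)
  filter_upwards [ae_unitCubeMeasure_floor_add_mem x] with u hu hmem
  have hlt : |∑ j, x j * ⌊x j + u j⌋ - ∑ j, x j ^ 2| < N := not_le.1 hmem
  have hlt' := (abs_lt.1 hlt).2
  have hsq : ∑ j, ((⌊x j + u j⌋ : ℝ) - x j) ^ 2 ≤ d := by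
    calc ∑ j, ((⌊x j + u j⌋ : ℝ) - x j) ^ 2 ≤ ∑ _j : Fin d, (1 : ℝ) :=
          Finset.sum_le_sum fun j _ => by
            have h1 := (hu j).1
            have h2 := (hu j).2
            have h3 := Int.floor_le (x j)
            have h4 := Int.lt_floor_add_one (x j)
            rw [sq_le_one_iff_abs_le_one, abs_le]
            constructor <;> linarith
      _ = d := by simp
  have e : ∑ j, (⌊x j + u j⌋ : ℝ) ^ 2 = ∑ j, ((⌊x j + u j⌋ : ℝ) - x j) ^ 2 +
      2 * (∑ j, x j * ⌊x j + u j⌋ - ∑ j, x j ^ 2) + ∑ j, x j ^ 2 := by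
    simp only [Finset.mul_sum, mul_sub, ← Finset.sum_add_distrib, ← Finset.sum_sub_distrib]
    exact Finset.sum_congr rfl fun j _ => by ring
  change ∑ j, (⌊x j + u j⌋ : ℝ) ^ 2 ≤ N ^ 2
  linarith

theorem volume_floorVec_preimage_le {d : ℕ} {L : Set (Fin d → ℤ)} (hL : L.Finite) :
    volume (floorVec ⁻¹' L) ≤ L.ncard := by
  have hcover : floorVec ⁻¹' L ⊆ ⋃ y ∈ hL.toFinset,
      Set.pi Set.univ fun j : Fin d => Set.Ico (y j : ℝ) (y j + 1) := fun x hx => by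
    refine Set.mem_iUnion₂.2 ⟨floorVec x, hL.mem_toFinset.2 hx, fun j _ => ?_⟩
    exact ⟨Int.floor_le _, Int.lt_floor_add_one _⟩
  calc volume (floorVec ⁻¹' L)
      ≤ ∑ y ∈ hL.toFinset, volume (Set.pi Set.univ fun j : Fin d =>
          Set.Ico (y j : ℝ) (y j + 1)) :=
        (measure_mono hcover).trans (measure_biUnion_finset_le _ _)
    _ = L.ncard := by
        rw [Set.ncard_eq_toFinset_card _ hL]
        simp [volume_pi_pi]

theorem three_quarters_mul_volume_le_ncard {d : ℕ} {N M : ℝ} (hN : 0 < N)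
    (hM : M ^ 2 + 2 * N + d ≤ N ^ 2) :
    3 / 4 * (volume (euclideanBall d M)).toReal ≤ (latticeBallSet d N).ncard := by
  set L := latticeBallSet d N
  set G : Set ((Fin d → ℝ) × (Fin d → ℝ)) := {p | floorVec (p.1 + p.2) ∈ L} with hG
  have hLmeas : MeasurableSet (floorVec ⁻¹' L) :=
    measurable_floorVec d (Set.to_countable L).measurableSet
  have hGmeas : MeasurableSet G := hLmeas.preimage (by fun_prop)
  have key : ENNReal.ofReal (3 / 4) * volume (euclideanBall d M) ≤ L.ncard := by
    calc ENNReal.ofReal (3 / 4) * volume (euclideanBall d M)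
        = ∫⁻ _ in euclideanBall d M, ENNReal.ofReal (3 / 4) := by simp
      _ ≤ ∫⁻ x in euclideanBall d M, unitCubeMeasure d (Prod.mk x ⁻¹' G) :=
          setLIntegral_mono' measurableSet_euclideanBall fun x hx =>
            three_quarters_le_unitCubeMeasure_floorVec_mem hN hM hx
      _ ≤ ∫⁻ x, unitCubeMeasure d (Prod.mk x ⁻¹' G) := setLIntegral_le_lintegral _ _
      _ = ∫⁻ u, volume ((fun x => (x, u)) ⁻¹' G) ∂unitCubeMeasure d := by
          rw [← Measure.prod_apply hGmeas, Measure.prod_apply_symm hGmeas]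
      _ ≤ ∫⁻ _, (L.ncard : ENNReal) ∂unitCubeMeasure d := lintegral_mono fun u => by
          have : (fun x => (x, u)) ⁻¹' G = (fun x => x + u) ⁻¹' (floorVec ⁻¹' L) := rfl
          rw [this, measure_preimage_add_right]
          exact volume_floorVec_preimage_le finite_latticeBallSet
      _ = L.ncard := by simp
  have := ENNReal.toReal_mono (ENNReal.natCast_ne_top _) key
  rwa [ENNReal.toReal_mul, ENNReal.toReal_ofReal (by norm_num), ENNReal.toReal_natCast] at this

theorem volume_le_four_mul_ncard_latticeBallSet {d : ℕ} (hd : 1 ≤ d) {N : ℝ}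
    (hN : 4 * (d : ℝ) ≤ N) :
    4⁻¹ * (volume (euclideanBall d N)).toReal ≤ (latticeBallSet d N).ncard := by
  have hd' : (1 : ℝ) ≤ d := by exact_mod_cast hd
  have hN0 : 0 < N := by linarith
  set s : ℝ := 2 / N + d / N ^ 2 with hs
  have hds : d * s ≤ 9 / 16 := by
    have hq : d / N ≤ 1 / 4 := by rw [div_le_iff₀ hN0]; linarith
    have hq0 : 0 ≤ d / N := by positivity
    have : d * s = 2 * (d / N) + (d / N) ^ 2 := by rw [hs]; field_simp
    nlinarith
  have hs0 : 0 ≤ s := by positivity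
  have hs1 : s ≤ 9 / 16 := by nlinarith
  set c := Real.sqrt (1 - s) with hc
  have hc0 : 0 < c := Real.sqrt_pos.2 (by linarith)
  have hcsq : c ^ 2 = 1 - s := Real.sq_sqrt (by linarith)
  have hcle : 1 - s ≤ c := by nlinarith
  have hpow : 7 / 16 ≤ c ^ d := by
    calc (7 / 16 : ℝ) ≤ 1 + d * (-s) := by linarith
      _ ≤ (1 + -s) ^ d := one_add_mul_le_pow (by linarith) d
      _ ≤ c ^ d := pow_le_pow_left₀ (by linarith) (by linarith) d
  have hM : (c * N) ^ 2 + 2 * N + d ≤ N ^ 2 := by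
    rw [mul_pow, hcsq, hs]
    refine le_of_eq ?_
    field_simp
    ring
  have h := three_quarters_mul_volume_le_ncard hN0 hM
  rw [volume_euclideanBall_mul d N hc0] at h
  have hv : 0 ≤ (volume (euclideanBall d N)).toReal := ENNReal.toReal_nonneg
  nlinarith [mul_le_mul_of_nonneg_right hpow hv]

end LowerBound

/-- Lemma 3.12: for `N ≥ C₁ d`, the number of lattice points in the
Euclidean ball `B_N` is comparable with its volume:
`C₂⁻¹ |B_N| ≤ #(B_N ∩ ℤ^d) ≤ 2 e^{1/(8C₁²)} |B_N|`. -/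
theorem lattice_points_in_ball_comparable_volume :
    ∃ C₁ C₂ : ℝ, 0 < C₁ ∧ 0 < C₂ ∧
      ∀ d : ℕ, 1 ≤ d → ∀ N : ℝ, C₁ * (d : ℝ) ≤ N →
        C₂⁻¹ * (volume (euclideanBall d N)).toReal ≤ ((latticeBallSet d N).ncard : ℝ) ∧
        ((latticeBallSet d N).ncard : ℝ) ≤
          2 * Real.exp (1 / (8 * C₁ ^ 2)) * (volume (euclideanBall d N)).toReal := by
  refine ⟨4, 4, by norm_num, by norm_num, fun d hd N hN => ⟨?_, ?_⟩⟩
  · exact volume_le_four_mul_ncard_latticeBallSet hd hN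
  · exact ncard_latticeBallSet_le (by norm_num) hd hN
end
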